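/- arXiv:2301.01963 — 11 statements merged into one kernel-verified Lean document; each statement's English description precedes it below -/
import Mathlib

section
/- Let L be a finite-dimensional Lie algebra over a field Ω with a free presentation, i.e., a surjective Lie algebra homomorphism π : F → L from a free Lie algebra F, with kernel R. Then B₀(L) is isomorphic as an Ω-vector space to the quotient (F' ∩ R)/⟨K(F) ∩ R⟩. -/
variable (Ω : Type*) [Field Ω] (L : Type*) [LieRing L] [LieAlgebra Ω L]

/-- `K(L)`: the set of brackets of a Lie algebra `L`. -/
def bracketSet : Set L := {z | ∃ x y : L, z = ⁅x, y⁆}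

/-- `f : L × L → Ω` is a 2-cocycle (with values in the trivial module `Ω`) if it is
bilinear, alternating and satisfies the cocycle identity. -/
def IsTwoCocycle (f : L → L → Ω) : Prop :=
  (∀ x x' y : L, f (x + x') y = f x y + f x' y) ∧
  (∀ x y y' : L, f x (y + y') = f x y + f x y') ∧
  (∀ (a : Ω) (x y : L), f (a • x) y = a * f x y) ∧
  (∀ (a : Ω) (x y : L), f x (a • y) = a * f x y) ∧
  (∀ x : L, f x x = 0) ∧
  (∀ x y z : L, f ⁅x, y⁆ z + f ⁅y, z⁆ x + f ⁅z, x⁆ y = 0)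

/-- `f : L × L → Ω` is a 2-coboundary if `f (x, y) = -σ ⁅x, y⁆` for some linear `σ`. -/
def IsTwoCoboundary (f : L → L → Ω) : Prop :=
  ∃ σ : L →ₗ[Ω] Ω, ∀ x y : L, f x y = -σ ⁅x, y⁆

/-- The subspace of 2-cocycles inside the space of all maps `L → L → Ω`. -/
def twoCocycles : Submodule Ω (L → L → Ω) where
  carrier := {f | IsTwoCocycle Ω L f}
  add_mem' := by
    rintro f g ⟨hf1, hf2, hf3, hf4, hf5, hf6⟩ ⟨hg1, hg2, hg3, hg4, hg5, hg6⟩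
    refine ⟨fun x x' y => ?_, fun x y y' => ?_, fun a x y => ?_, fun a x y => ?_,
      fun x => ?_, fun x y z => ?_⟩ <;>
      simp only [Pi.add_apply]
    · rw [hf1, hg1]; ring
    · rw [hf2, hg2]; ring
    · rw [hf3, hg3]; ring
    · rw [hf4, hg4]; ring
    · rw [hf5, hg5]; ring
    · linear_combination hf6 x y z + hg6 x y z
  zero_mem' := by
    refine ⟨?_, ?_, ?_, ?_, ?_, ?_⟩ <;> simp
  smul_mem' := by
    rintro c f ⟨hf1, hf2, hf3, hf4, hf5, hf6⟩
    refine ⟨fun x x' y => ?_, fun x y y' => ?_, fun a x y => ?_, fun a x y => ?_,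
      fun x => ?_, fun x y z => ?_⟩ <;>
      simp only [Pi.smul_apply, smul_eq_mul]
    · rw [hf1]; ring
    · rw [hf2]; ring
    · rw [hf3]; ring
    · rw [hf4]; ring
    · rw [hf5]; ring
    · linear_combination c * hf6 x y z

/-- The subspace of 2-coboundaries inside the space of all maps `L → L → Ω`. -/
def twoCoboundaries : Submodule Ω (L → L → Ω) where
  carrier := {f | IsTwoCoboundary Ω L f}
  add_mem' := by
    rintro f g ⟨σ, hσ⟩ ⟨τ, hτ⟩
    refine ⟨σ + τ, fun x y => ?_⟩
    simp only [Pi.add_apply, LinearMap.add_apply, hσ x y, hτ x y]; ring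
  zero_mem' := ⟨0, by simp⟩
  smul_mem' := by
    rintro c f ⟨σ, hσ⟩
    refine ⟨c • σ, fun x y => ?_⟩
    simp only [Pi.smul_apply, LinearMap.smul_apply, hσ x y, smul_eq_mul]; ring

/-- The 2-coboundaries viewed as a subspace of the space of 2-cocycles. -/
def twoCoboundariesIn : Submodule Ω (twoCocycles Ω L) :=
  (twoCoboundaries Ω L).comap (twoCocycles Ω L).subtype

/-- The second cohomology `H²(L,Ω)` of `L` with coefficients in the trivial module `Ω`:
2-cocycles modulo 2-coboundaries. -/
abbrev lieH2 := twoCocycles Ω L ⧸ twoCoboundariesIn Ω L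

/-- The cohomology class of a 2-cocycle. -/
def H2class (f : L → L → Ω) (hf : f ∈ twoCocycles Ω L) : lieH2 Ω L :=
  Submodule.Quotient.mk ⟨f, hf⟩

/-- The subspace of maps `L → L → Ω` vanishing on all pairs of commuting elements. -/
def vanishingOnCommuting : Submodule Ω (L → L → Ω) where
  carrier := {f | ∀ x y : L, ⁅x, y⁆ = 0 → f x y = 0}
  add_mem' := by
    intro f g hf hg x y hxy
    simp [Pi.add_apply, hf x y hxy, hg x y hxy]
  zero_mem' := fun x y _ => rfl
  smul_mem' := by
    intro c f hf x y hxy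
    simp [Pi.smul_apply, hf x y hxy]

/-- The Bogomolov multiplier `B₀(L)`: the subspace of `H²(L,Ω)` consisting of the classes
of 2-cocycles `f` such that `f (x, y) = 0` whenever `⁅x, y⁆ = 0`. -/
def B0 : Submodule Ω (lieH2 Ω L) :=
  Submodule.map (twoCoboundariesIn Ω L).mkQ
    ((vanishingOnCommuting Ω L).comap (twoCocycles Ω L).subtype)


/-- The central extension of `L` by `Ω` attached to a 2-cocycle. -/
def CExt {Ω : Type*} [Field Ω] {L : Type*} [LieRing L] [LieAlgebra Ω L]
    (_c : twoCocycles Ω L) := L × Ω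

namespace CExt

variable {Ω : Type*} [Field Ω] {L : Type*} [LieRing L] [LieAlgebra Ω L] (c : twoCocycles Ω L)

instance : AddCommGroup (CExt c) := inferInstanceAs (AddCommGroup (L × Ω))

instance : Module Ω (CExt c) := inferInstanceAs (Module Ω (L × Ω))

theorem skew (x y : L) : c.1 x y = - c.1 y x := by
  obtain ⟨h1, h2, -, -, h5, -⟩ := c.2
  have h := h5 (x + y)
  rw [h1, h2, h2, h5, h5] at h
  linear_combination h

instance : LieRing (CExt c) where
  bracket a b := ((⁅a.1, b.1⁆, c.1 a.1 b.1) : L × Ω)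
  add_lie a b d := by
    refine Prod.ext (add_lie (L := L) (M := L) a.1 b.1 d.1) (c.2.1 a.1 b.1 d.1)
  lie_add a b d := by
    refine Prod.ext (lie_add (L := L) (M := L) a.1 b.1 d.1) (c.2.2.1 a.1 b.1 d.1)
  lie_self a := by
    refine Prod.ext (lie_self (L := L) a.1) (c.2.2.2.2.2.1 a.1)
  leibniz_lie a b d := by
    refine Prod.ext (leibniz_lie (a.1 : L) b.1 d.1) ?_
    change c.1 a.1 ⁅b.1, d.1⁆ = c.1 ⁅a.1, b.1⁆ d.1 + c.1 b.1 ⁅a.1, d.1⁆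
    have h := c.2.2.2.2.2.2 a.1 b.1 d.1
    have h1 := skew c ⁅b.1, d.1⁆ a.1
    have h2 := skew c ⁅d.1, a.1⁆ b.1
    have h3 : c.1 b.1 ⁅d.1, a.1⁆ = - c.1 b.1 ⁅a.1, d.1⁆ := by
      rw [← lie_skew d.1 a.1, ← neg_one_smul Ω, c.2.2.2.2.1]; simp
    linear_combination -h + h1 + h2 - h3

instance : LieAlgebra Ω (CExt c) where
  lie_smul t a b := by
    refine Prod.ext (lie_smul (L := L) (M := L) t a.1 b.1) (c.2.2.2.2.1 t a.1 b.1)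

/-- projection -/
def fstHom : CExt c →ₗ⁅Ω⁆ L where
  toFun a := a.1
  map_add' _ _ := rfl
  map_smul' _ _ := rfl
  map_lie' := rfl

/-- second coordinate -/
def sndLin : CExt c →ₗ[Ω] Ω where
  toFun a := a.2
  map_add' _ _ := rfl
  map_smul' _ _ := rfl

/-- set-theoretic section -/
def inc (x : L) : CExt c := ((x, 0) : L × Ω)

theorem exists_potential {X : Type*} (π : FreeLieAlgebra Ω X →ₗ⁅Ω⁆ L) :
    ∃ τ : FreeLieAlgebra Ω X →ₗ[Ω] Ω, ∀ x y, τ ⁅x, y⁆ = c.1 (π x) (π y) := by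
  let g : FreeLieAlgebra Ω X →ₗ⁅Ω⁆ CExt c :=
    FreeLieAlgebra.lift Ω (L := CExt c) (inc c ∘ π ∘ FreeLieAlgebra.of Ω)
  have hg : (fstHom c).comp g = π := by
    ext x
    simp only [g, LieHom.comp_apply, FreeLieAlgebra.lift_of_apply]
    rfl
  have hg' : ∀ x, (g x).1 = π x := fun x => LieHom.congr_fun hg x
  refine ⟨(sndLin c).comp (g : FreeLieAlgebra Ω X →ₗ[Ω] CExt c), fun x y => ?_⟩
  change (g ⁅x, y⁆).2 = _
  rw [LieHom.map_lie, ← hg', ← hg']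
  rfl

end CExt

section Hopf

variable {Ω : Type*} [Field Ω] {L : Type*} [LieRing L] [LieAlgebra Ω L]
  {F : Type*} [LieRing F] [LieAlgebra Ω F] (π : F →ₗ⁅Ω⁆ L)

/-- Functionals on `F` killing `K(F) ∩ R`. -/
def killing0 : Submodule Ω (F →ₗ[Ω] Ω) where
  carrier := {τ | ∀ x y : F, π ⁅x, y⁆ = 0 → τ ⁅x, y⁆ = 0}
  add_mem' := by
    intro a b ha hb x y h
    simp [ha x y h, hb x y h]
  zero_mem' := by intro x y _; rfl
  smul_mem' := by
    intro t a ha x y h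
    simp [ha x y h]

theorem killing0_congr {τ : F →ₗ[Ω] Ω} (hτ : τ ∈ killing0 π) {x x' y y' : F}
    (hx : π x = π x') (hy : π y = π y') : τ ⁅x, y⁆ = τ ⁅x', y'⁆ := by
  have h1 := hτ (x - x') y (by simp [hx])
  have h2 := hτ x' (y - y') (by simp [hy])
  rw [sub_lie, map_sub] at h1
  rw [lie_sub, map_sub] at h2
  linear_combination h1 + h2

variable {π} in
/-- cocycle attached to a functional -/
def cocOf {s : L → F} (hs : ∀ x, π (s x) = x) : killing0 π →ₗ[Ω] twoCocycles Ω L where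
  toFun τ := ⟨fun x y => τ.1 ⁅s x, s y⁆, by
    obtain ⟨τ, hτ⟩ := τ
    refine ⟨fun x x' y => ?_, fun x y y' => ?_, fun a x y => ?_, fun a x y => ?_,
      fun x => ?_, fun x y z => ?_⟩
    · rw [← map_add, ← add_lie]; exact killing0_congr π hτ (by simp [hs]) rfl
    · rw [← map_add, ← lie_add]; exact killing0_congr π hτ rfl (by simp [hs])
    · rw [← smul_eq_mul, ← map_smul, ← smul_lie]; exact killing0_congr π hτ (by simp [hs]) rfl
    · rw [← smul_eq_mul, ← map_smul, ← lie_smul]; exact killing0_congr π hτ rfl (by simp [hs])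
    · simp
    · have h : ∀ x y z : L, τ ⁅s ⁅x, y⁆, s z⁆ = τ ⁅⁅s x, s y⁆, s z⁆ := fun x y z =>
        killing0_congr π hτ (by simp [hs]) rfl
      simp only [h]
      have hj := congrArg τ (lie_jacobi (s x) (s y) (s z))
      rw [map_add, map_add, map_zero, ← lie_skew (s x) ⁅s y, s z⁆, ← lie_skew (s y) ⁅s z, s x⁆,
        ← lie_skew (s z) ⁅s x, s y⁆,
        map_neg, map_neg, map_neg] at hj
      linear_combination -hj⟩
  map_add' _ _ := rfl
  map_smul' _ _ := rfl

variable {π} in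
theorem cocOf_apply {s : L → F} (hs : ∀ x, π (s x) = x) (τ : killing0 π) (x y : F) :
    (cocOf hs τ).1 (π x) (π y) = τ.1 ⁅x, y⁆ :=
  killing0_congr π τ.2 (hs _) (hs _)

variable {π} in
theorem cocOf_vanish {s : L → F} (hs : ∀ x, π (s x) = x) (τ : killing0 π) :
    (cocOf hs τ).1 ∈ vanishingOnCommuting Ω L := by
  intro x y h
  exact τ.2 _ _ (by simp [hs, h])

variable {π} in
/-- the map to `B0` -/
def toB0 {s : L → F} (hs : ∀ x, π (s x) = x) : killing0 π →ₗ[Ω] B0 Ω L :=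
  ((twoCoboundariesIn Ω L).mkQ.comp (cocOf hs)).codRestrict (B0 Ω L)
    (fun τ => ⟨cocOf hs τ, cocOf_vanish hs τ, rfl⟩)

variable (Ω F) in
/-- the derived subalgebra -/
abbrev der := Submodule.span Ω (bracketSet F)

/-- derived subalgebra intersected with R -/
abbrev derR : Submodule Ω F := der Ω F ⊓ (π.ker : Submodule Ω F)

/-- span of the brackets in R -/
abbrev KR : Submodule Ω (derR π) :=
  (Submodule.span Ω (bracketSet F ∩ (π.ker : Set F))).comap (derR π).subtype

theorem killing0_span {τ : F →ₗ[Ω] Ω} (hτ : τ ∈ killing0 π) :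
    KR π ≤ LinearMap.ker (τ.comp (derR π).subtype) := by
  intro z hz
  have : Submodule.span Ω (bracketSet F ∩ (π.ker : Set F)) ≤ LinearMap.ker τ := by
    rw [Submodule.span_le]
    rintro _ ⟨⟨x, y, rfl⟩, h⟩
    exact hτ x y (by simpa using h)
  exact this hz

/-- the map to the dual -/
def toDual : killing0 π →ₗ[Ω] ((derR π ⧸ KR π) →ₗ[Ω] Ω) where
  toFun τ := (KR π).liftQ (τ.1.comp (derR π).subtype) (killing0_span π τ.2)
  map_add' _ _ := by ext; rfl
  map_smul' _ _ := by ext; rfl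

theorem toDual_surj : Function.Surjective (toDual π) := by
  intro φ
  obtain ⟨τ, hτ⟩ := LinearMap.exists_extend (φ.comp (KR π).mkQ)
  have hτ' : ∀ z : derR π, τ z = φ ((KR π).mkQ z) := fun z => LinearMap.congr_fun hτ z
  refine ⟨⟨τ, fun x y h => ?_⟩, ?_⟩
  · have hm : ⁅x, y⁆ ∈ derR π :=
      ⟨Submodule.subset_span ⟨x, y, rfl⟩, by simpa using h⟩
    have h2 := hτ' ⟨_, hm⟩
    rw [show (KR π).mkQ ⟨_, hm⟩ = 0 from ?_, map_zero] at h2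
    · exact h2
    · rw [Submodule.mkQ_apply, Submodule.Quotient.mk_eq_zero]
      exact Submodule.subset_span ⟨⟨x, y, rfl⟩, by simpa using h⟩
  · ext z
    exact hτ' z

variable {π} in
theorem ker_eq {s : L → F} (hs : ∀ x, π (s x) = x) :
    LinearMap.ker (toB0 hs) = LinearMap.ker (toDual π) := by
  have hsurj : Function.Surjective π := fun x => ⟨s x, hs x⟩
  ext τ
  have e1 : τ ∈ LinearMap.ker (toB0 hs) ↔
      ∃ σ : L →ₗ[Ω] Ω, ∀ x y : L, (cocOf hs τ).1 x y = -σ ⁅x, y⁆ := by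
    rw [LinearMap.mem_ker, ← Subtype.coe_inj]
    change Submodule.Quotient.mk (p := twoCoboundariesIn Ω L) (cocOf hs τ) = 0 ↔ _
    rw [Submodule.Quotient.mk_eq_zero]
    rfl
  have e2 : τ ∈ LinearMap.ker (toDual π) ↔ ∀ z ∈ derR π, τ.1 z = 0 := by
    rw [LinearMap.mem_ker]
    constructor
    · intro h z hz
      exact LinearMap.congr_fun h ((KR π).mkQ ⟨z, hz⟩)
    · intro h
      ext z
      exact h z.1 z.2
  rw [e1, e2]
  constructor
  · rintro ⟨σ, hσ⟩ z ⟨hz, hz'⟩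
    have : der Ω F ≤ LinearMap.ker (τ.1 + σ.comp (π : F →ₗ[Ω] L)) := by
      rw [Submodule.span_le]
      rintro _ ⟨x, y, rfl⟩
      have := hσ (π x) (π y)
      rw [cocOf_apply] at this
      simp [this]
    have h := this hz
    have hz0 : π z = 0 := by simpa using hz'
    simpa [hz0] using h
  · intro h
    let p : der Ω F →ₗ[Ω] L := (π : F →ₗ[Ω] L).comp (der Ω F).subtype
    let q : der Ω F →ₗ[Ω] Ω := τ.1.comp (der Ω F).subtype
    have hpq : LinearMap.ker p ≤ LinearMap.ker q := by
      intro z hz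
      exact h z.1 ⟨z.2, by simpa [p] using hz⟩
    obtain ⟨σ, hσ⟩ := LinearMap.exists_extend
      (((LinearMap.ker p).liftQ q hpq).comp p.quotKerEquivRange.symm.toLinearMap)
    have key : ∀ z : der Ω F, σ (π z) = τ.1 z := by
      intro z
      have h1 := LinearMap.congr_fun hσ ⟨p z, z, rfl⟩
      have h2 : p.quotKerEquivRange.symm ⟨p z, z, rfl⟩ = (LinearMap.ker p).mkQ z := by
        rw [LinearEquiv.symm_apply_eq]; rfl
      simp only [LinearMap.comp_apply, LinearEquiv.coe_coe, h2] at h1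
      exact h1
    refine ⟨-σ, fun x y => ?_⟩
    obtain ⟨x, rfl⟩ := hsurj x
    obtain ⟨y, rfl⟩ := hsurj y
    rw [cocOf_apply, ← LieHom.map_lie]
    have := key ⟨⁅x, y⁆, Submodule.subset_span ⟨x, y, rfl⟩⟩
    simpa using this.symm

theorem toB0_surj {X : Type*} {π : FreeLieAlgebra Ω X →ₗ⁅Ω⁆ L} {s : L → FreeLieAlgebra Ω X}
    (hs : ∀ x, π (s x) = x) : Function.Surjective (toB0 hs) := by
  rintro ⟨_, c, hc, rfl⟩
  obtain ⟨τ, hτ⟩ := CExt.exists_potential c π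
  refine ⟨⟨τ, fun x y h => ?_⟩, ?_⟩
  · rw [hτ]; exact hc _ _ (by simpa using h)
  · apply Subtype.ext
    change (twoCoboundariesIn Ω L).mkQ (cocOf hs _) = _
    congr 1
    apply Subtype.ext
    funext x y
    change τ ⁅s x, s y⁆ = _
    rw [hτ, hs, hs]

theorem B0_finite [FiniteDimensional Ω L] : FiniteDimensional Ω (B0 Ω L) := by
  let g : twoCocycles Ω L →ₗ[Ω] (L →ₗ[Ω] L →ₗ[Ω] Ω) :=
    { toFun := fun c => LinearMap.mk₂ Ω c.1 c.2.1 c.2.2.2.1 c.2.2.1 c.2.2.2.2.1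
      map_add' := fun _ _ => by ext; rfl
      map_smul' := fun _ _ => by ext; rfl }
  have hg : Function.Injective g := by
    intro a b h
    apply Subtype.ext
    funext x y
    exact LinearMap.congr_fun₂ h x y
  have : Module.Finite Ω (twoCocycles Ω L) := Module.Finite.of_injective g hg
  infer_instance

end Hopf

/-- **Hopf-type formula for the Bogomolov multiplier of a Lie algebra.**
If `L ≅ F/R` is a free presentation of a finite-dimensional Lie algebra `L`
(`F` a free Lie algebra, `R` the kernel of the presentation), then
`B₀(L) ≅ (F' ∩ R) / ⟨K(F) ∩ R⟩` as `Ω`-vector spaces.  Here the derived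
subalgebra `F' = [F,F]` is the linear span of `K(F)`. -/
theorem bogomolov_hopf_type_formula
    (Ω : Type*) [Field Ω] (L : Type*) [LieRing L] [LieAlgebra Ω L] [FiniteDimensional Ω L]
    (X : Type*) (π : FreeLieAlgebra Ω X →ₗ⁅Ω⁆ L) (hπ : Function.Surjective π) :
    Nonempty (↥(B0 Ω L) ≃ₗ[Ω]
      (↥(Submodule.span Ω (bracketSet (FreeLieAlgebra Ω X)) ⊓
          (π.ker : Submodule Ω (FreeLieAlgebra Ω X))) ⧸
        (Submodule.span Ω
            (bracketSet (FreeLieAlgebra Ω X) ∩ (π.ker : Set (FreeLieAlgebra Ω X)))).comap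
          (Submodule.span Ω (bracketSet (FreeLieAlgebra Ω X)) ⊓
            (π.ker : Submodule Ω (FreeLieAlgebra Ω X))).subtype)) := by
  obtain ⟨s, hs'⟩ := hπ.hasRightInverse
  have hs : ∀ x, π (s x) = x := hs'
  let e1 := LinearMap.quotKerEquivOfSurjective (R := Ω) (M := killing0 π) (toB0 hs) (toB0_surj hs)
  let e2 := LinearMap.quotKerEquivOfSurjective (R := Ω) (M := killing0 π) (toDual π) (toDual_surj π)
  let e : B0 Ω L ≃ₗ[Ω] ((derR π ⧸ KR π) →ₗ[Ω] Ω) :=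
    e1.symm ≪≫ₗ Submodule.quotEquivOfEq _ _ (ker_eq hs) ≪≫ₗ e2
  have := B0_finite (Ω := Ω) (L := L)
  have hd : FiniteDimensional Ω (Module.Dual Ω (derR π ⧸ KR π)) := e.finiteDimensional
  have hq : FiniteDimensional Ω (derR π ⧸ KR π) := Module.finite_dual_iff Ω |>.1 hd
  exact ⟨e ≪≫ₗ (Module.finBasis Ω (derR π ⧸ KR π)).toDualEquiv.symm⟩
end

section
/- Let L and M be two isoclinic finite-dimensional Lie algebras over the field Ω. Then B₀(L) and B₀(M) are isomorphic as Ω-vector spaces. -/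
variable (Ω : Type*) [Field Ω] (L : Type*) [LieRing L] [LieAlgebra Ω L]

/-- cocycles vanishing on commuting pairs -/
def VC (Ω : Type*) [Field Ω] (L : Type*) [LieRing L] [LieAlgebra Ω L] :
    Submodule Ω (L → L → Ω) := twoCocycles Ω L ⊓ vanishingOnCommuting Ω L

/-- projection to B0 -/
def projB0 (Ω : Type*) [Field Ω] (L : Type*) [LieRing L] [LieAlgebra Ω L] :
    VC Ω L →ₗ[Ω] B0 Ω L :=
  LinearMap.codRestrict (B0 Ω L)
    ((twoCoboundariesIn Ω L).mkQ ∘ₗ (Submodule.inclusion (inf_le_left : VC Ω L ≤ twoCocycles Ω L)))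
    (fun f => ⟨⟨f.1, f.2.1⟩, f.2.2, rfl⟩)

lemma projB0_surj (Ω : Type*) [Field Ω] (L : Type*) [LieRing L] [LieAlgebra Ω L] :
    Function.Surjective (projB0 Ω L) := by
  rintro ⟨_, ⟨f, hf⟩, hv, rfl⟩
  exact ⟨⟨f, hf, hv⟩, rfl⟩

lemma projB0_ker (Ω : Type*) [Field Ω] (L : Type*) [LieRing L] [LieAlgebra Ω L] (f : VC Ω L) :
    f ∈ LinearMap.ker (projB0 Ω L) ↔ IsTwoCoboundary Ω L f.1 := by
  rw [LinearMap.mem_ker, ← Subtype.coe_inj]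
  change (twoCoboundariesIn Ω L).mkQ _ = 0 ↔ _
  rw [Submodule.mkQ_apply, Submodule.Quotient.mk_eq_zero]
  rfl

lemma VC_congr {Ω : Type*} [Field Ω] {L : Type*} [LieRing L] [LieAlgebra Ω L]
    {f : L → L → Ω} (hf : f ∈ VC Ω L) {x x' y y' : L}
    (hx : x - x' ∈ LieAlgebra.center Ω L) (hy : y - y' ∈ LieAlgebra.center Ω L) :
    f x y = f x' y' := by
  obtain ⟨⟨h1, h2, -⟩, hv⟩ := hf
  have e1 : x = (x - x') + x' := by abel
  have e2 : y = (y - y') + y' := by abel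
  have hx' := (LieModule.mem_maxTrivSubmodule (R := Ω) (L := L) (M := L) _).1 hx
  have hy' := (LieModule.mem_maxTrivSubmodule (R := Ω) (L := L) (M := L) _).1 hy
  rw [e1, h1, hv (x - x') y (by rw [← lie_skew, hx', neg_zero]), zero_add, e2, h2,
    hv x' (y - y') (hy' _), zero_add]

/-- pullback -/
def pullVC {Ω : Type*} [Field Ω] {L : Type*} [LieRing L] [LieAlgebra Ω L]
    {M : Type*} [LieRing M] [LieAlgebra Ω M] (φ : M →ₗ[Ω] L)
    (ha : ∀ x y, φ ⁅x, y⁆ - ⁅φ x, φ y⁆ ∈ LieAlgebra.center Ω L)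
    (hb : ∀ x y, ⁅x, y⁆ = 0 → ⁅φ x, φ y⁆ = 0) : VC Ω L →ₗ[Ω] VC Ω M where
  toFun f := ⟨fun x y => f.1 (φ x) (φ y), by
    obtain ⟨f, hf⟩ := f
    have hc := fun x y z => VC_congr hf (ha x y)
      (show φ z - φ z ∈ LieAlgebra.center Ω L by rw [sub_self]; exact zero_mem _)
    obtain ⟨⟨h1, h2, h3, h4, h5, h6⟩, hv⟩ := hf
    refine ⟨⟨?_, ?_, ?_, ?_, ?_, ?_⟩, ?_⟩
    · intro x x' y; simp [h1]
    · intro x x' y; simp [h2]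
    · intro x x' y; simp [h3]
    · intro x x' y; simp [h4]
    · intro x; simp [h5]
    · intro x y z
      simp only [hc, h6]
    · intro x y hxy
      exact hv _ _ (hb _ _ hxy)⟩
  map_add' f g := rfl
  map_smul' c f := rfl

lemma lift_exists {Ω : Type*} [Field Ω] {L : Type*} [LieRing L] [LieAlgebra Ω L]
    {M : Type*} [LieRing M] [LieAlgebra Ω M] 
    (α : (M ⧸ LieAlgebra.center Ω M) ≃ₗ⁅Ω⁆ (L ⧸ LieAlgebra.center Ω L)) :
    ∃ φ : M →ₗ[Ω] L, ∀ m, α (LieSubmodule.Quotient.mk (N := LieAlgebra.center Ω M) m) =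
        LieSubmodule.Quotient.mk (N := LieAlgebra.center Ω L) (φ m) := by
  obtain ⟨s, hs⟩ := (LieAlgebra.center Ω L).toSubmodule.mkQ.exists_rightInverse_of_surjective
    (Submodule.range_mkQ _)
  refine ⟨s ∘ₗ (α : _ →ₗ[Ω] _) ∘ₗ (LieAlgebra.center Ω M).toSubmodule.mkQ, fun m => ?_⟩
  exact (LinearMap.congr_fun hs _).symm

lemma lift_lie {Ω : Type*} [Field Ω] {L : Type*} [LieRing L] [LieAlgebra Ω L]
    {M : Type*} [LieRing M] [LieAlgebra Ω M] 
    (α : (M ⧸ LieAlgebra.center Ω M) ≃ₗ⁅Ω⁆ (L ⧸ LieAlgebra.center Ω L))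
    (φ : M →ₗ[Ω] L) (h : ∀ m, α (LieSubmodule.Quotient.mk (N := LieAlgebra.center Ω M) m) =
        LieSubmodule.Quotient.mk (N := LieAlgebra.center Ω L) (φ m)) (x y : M) :
    φ ⁅x, y⁆ - ⁅φ x, φ y⁆ ∈ LieAlgebra.center Ω L := by
  refine (Submodule.Quotient.eq (LieAlgebra.center Ω L).toSubmodule).1 ?_
  change LieSubmodule.Quotient.mk (N := LieAlgebra.center Ω L) _ =
    LieSubmodule.Quotient.mk (N := LieAlgebra.center Ω L) _
  rw [← h, LieSubmodule.Quotient.mk_bracket, LieSubmodule.Quotient.mk_bracket, LieEquiv.map_lie, h, h]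

lemma lift_inv {Ω : Type*} [Field Ω] {L : Type*} [LieRing L] [LieAlgebra Ω L]
    {M : Type*} [LieRing M] [LieAlgebra Ω M] 
    (α : (M ⧸ LieAlgebra.center Ω M) ≃ₗ⁅Ω⁆ (L ⧸ LieAlgebra.center Ω L))
    (φ : M →ₗ[Ω] L) (h : ∀ m, α (LieSubmodule.Quotient.mk (N := LieAlgebra.center Ω M) m) =
        LieSubmodule.Quotient.mk (N := LieAlgebra.center Ω L) (φ m))
    (ψ : L →ₗ[Ω] M) (h' : ∀ m, α.symm (LieSubmodule.Quotient.mk (N := LieAlgebra.center Ω L) m) =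
        LieSubmodule.Quotient.mk (N := LieAlgebra.center Ω M) (ψ m)) (x : M) :
    ψ (φ x) - x ∈ LieAlgebra.center Ω M := by
  refine (Submodule.Quotient.eq (LieAlgebra.center Ω M).toSubmodule).1 ?_
  change LieSubmodule.Quotient.mk (N := LieAlgebra.center Ω M) _ =
    LieSubmodule.Quotient.mk (N := LieAlgebra.center Ω M) _
  rw [← h', ← h, LieEquiv.symm_apply_apply]

lemma lie_mem_der (Ω : Type*) [Field Ω] {L : Type*} [LieRing L] [LieAlgebra Ω L] (x y : L) :
    ⁅x, y⁆ ∈ LieAlgebra.derivedSeries Ω L 1 := by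
  rw [LieAlgebra.derivedSeries_def, LieAlgebra.derivedSeriesOfIdeal_succ,
    LieAlgebra.derivedSeriesOfIdeal_zero]
  exact LieSubmodule.lie_mem_lie (LieSubmodule.mem_top _) (LieSubmodule.mem_top _)

lemma cob_pull {Ω : Type*} [Field Ω] {L : Type*} [LieRing L] [LieAlgebra Ω L]
    {M : Type*} [LieRing M] [LieAlgebra Ω M] (φ : M →ₗ[Ω] L)
    (β : ↥(LieAlgebra.derivedSeries Ω M 1) →ₗ[Ω] ↥(LieAlgebra.derivedSeries Ω L 1))
    (h : ∀ x y, (β ⟨⁅x, y⁆, lie_mem_der Ω x y⟩ : L) = ⁅φ x, φ y⁆)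
    (f : L → L → Ω) (hf : IsTwoCoboundary Ω L f) :
    IsTwoCoboundary Ω M (fun x y => f (φ x) (φ y)) := by
  obtain ⟨σ, hσ⟩ := hf
  obtain ⟨τ, hτ⟩ := LinearMap.exists_extend (p := (LieAlgebra.derivedSeries Ω M 1).toSubmodule)
    (σ ∘ₗ (LieAlgebra.derivedSeries Ω L 1).toSubmodule.subtype ∘ₗ β)
  refine ⟨τ, fun x y => ?_⟩
  have := LinearMap.congr_fun hτ ⟨⁅x, y⁆, lie_mem_der Ω x y⟩
  have h2 : τ ⁅x, y⁆ = σ (β ⟨⁅x, y⁆, lie_mem_der Ω x y⟩ : L) := this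
  rw [h2, h]
  exact hσ _ _

/-- **Isoclinism invariance of the Bogomolov multiplier.**
If `L` and `M` are isoclinic finite-dimensional Lie algebras over `Ω` — that is,
there are isomorphisms `α : L/Z(L) ≃ M/Z(M)` and `β : L' ≃ M'` compatible with
the brackets — then `B₀(L) ≅ B₀(M)` as `Ω`-vector spaces. -/
theorem bogomolov_isoclinism_invariant
    (Ω : Type*) [Field Ω]
    (L : Type*) [LieRing L] [LieAlgebra Ω L] [FiniteDimensional Ω L]
    (M : Type*) [LieRing M] [LieAlgebra Ω M] [FiniteDimensional Ω M]
    (α : (L ⧸ LieAlgebra.center Ω L) ≃ₗ⁅Ω⁆ (M ⧸ LieAlgebra.center Ω M))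
    (β : ↥(LieAlgebra.derivedSeries Ω L 1) ≃ₗ⁅Ω⁆ ↥(LieAlgebra.derivedSeries Ω M 1))
    (hcompat : ∀ (x : LieAlgebra.derivedSeries Ω L 1) (l₁ l₂ : L) (m₁ m₂ : M),
      (x : L) = ⁅l₁, l₂⁆ →
      α (LieSubmodule.Quotient.mk (N := LieAlgebra.center Ω L) l₁) =
        LieSubmodule.Quotient.mk (N := LieAlgebra.center Ω M) m₁ →
      α (LieSubmodule.Quotient.mk (N := LieAlgebra.center Ω L) l₂) =
        LieSubmodule.Quotient.mk (N := LieAlgebra.center Ω M) m₂ →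
      ((β x : ↥(LieAlgebra.derivedSeries Ω M 1)) : M) = ⁅m₁, m₂⁆) :
    Nonempty (↥(B0 Ω L) ≃ₗ[Ω] ↥(B0 Ω M)) := by
  obtain ⟨ψ, hψ⟩ := lift_exists α
  obtain ⟨φ, hφ⟩ := lift_exists α.symm
  have hφ' : ∀ m, α (LieSubmodule.Quotient.mk (N := LieAlgebra.center Ω L) (φ m)) =
      LieSubmodule.Quotient.mk (N := LieAlgebra.center Ω M) m := fun m => by
    rw [← hφ, LieEquiv.apply_symm_apply]
  have kψ : ∀ x y : L, (β ⟨⁅x, y⁆, lie_mem_der Ω x y⟩ : M) = ⁅ψ x, ψ y⁆ := fun x y =>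
    hcompat _ x y _ _ rfl (hψ x) (hψ y)
  have kφ : ∀ x y : M, (β.symm ⟨⁅x, y⁆, lie_mem_der Ω x y⟩ : L) = ⁅φ x, φ y⁆ := fun x y => by
    have h1 := hcompat ⟨_, lie_mem_der Ω (φ x) (φ y)⟩ _ _ x y rfl (hφ' x) (hφ' y)
    have h2 : β ⟨_, lie_mem_der Ω (φ x) (φ y)⟩ = ⟨⁅x, y⁆, lie_mem_der Ω x y⟩ := Subtype.ext h1
    rw [← h2, LieEquiv.symm_apply_apply]
  have bψ : ∀ x y : L, ⁅x, y⁆ = 0 → ⁅ψ x, ψ y⁆ = 0 := fun x y h => by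
    rw [← kψ]
    have : (⟨⁅x, y⁆, lie_mem_der Ω x y⟩ : LieAlgebra.derivedSeries Ω L 1) = 0 := Subtype.ext h
    rw [this, map_zero]; rfl
  have bφ : ∀ x y : M, ⁅x, y⁆ = 0 → ⁅φ x, φ y⁆ = 0 := fun x y h => by
    rw [← kφ]
    have : (⟨⁅x, y⁆, lie_mem_der Ω x y⟩ : LieAlgebra.derivedSeries Ω M 1) = 0 := Subtype.ext h
    rw [this, map_zero]; rfl
  have iL : ∀ x, φ (ψ x) - x ∈ LieAlgebra.center Ω L := lift_inv α ψ hψ φ hφ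
  have iM : ∀ x, ψ (φ x) - x ∈ LieAlgebra.center Ω M := lift_inv α.symm φ hφ ψ hψ
  let e : VC Ω L ≃ₗ[Ω] VC Ω M := LinearEquiv.ofLinearMap
    (pullVC φ (lift_lie α.symm φ hφ) bφ) (pullVC ψ (lift_lie α ψ hψ) bψ)
    (LinearMap.ext fun f => Subtype.ext (funext fun x => funext fun y =>
      VC_congr f.2 (iM x) (iM y)))
    (LinearMap.ext fun f => Subtype.ext (funext fun x => funext fun y =>
      VC_congr f.2 (iL x) (iL y)))
  have hker : (LinearMap.ker (projB0 Ω L)).map (e : VC Ω L →ₗ[Ω] VC Ω M) =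
      LinearMap.ker (projB0 Ω M) := by
    ext g
    constructor
    · rintro ⟨f, hf, rfl⟩
      exact (projB0_ker Ω M _).2 (cob_pull φ (β.symm : _ →ₗ[Ω] _) kφ f.1 ((projB0_ker Ω L f).1 hf))
    · intro hg
      refine ⟨e.symm g, ?_, e.apply_symm_apply g⟩
      exact (projB0_ker Ω L _).2 (cob_pull ψ (β : _ →ₗ[Ω] _) kψ g.1 ((projB0_ker Ω M g).1 hg))
  exact ⟨((projB0 Ω L).quotKerEquivOfSurjective (projB0_surj Ω L)).symm ≪≫ₗ
    Submodule.Quotient.equiv _ _ e hker ≪≫ₗ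
    (projB0 Ω M).quotKerEquivOfSurjective (projB0_surj Ω M)⟩
end

section
/- Let L be a finite-dimensional Lie algebra over a field Ω, H a central ideal of L (H ⊆ Z(L)), T = ⟨K(L) ∩ H⟩, π : L → L/H the natural projection, and μ : L/H → L a linear section of π. Define f_μ : L/H × L/H → H by f_μ(x,y) = [μ(x),μ(y)] − μ([x,y]). Then for a linear map λ : H → Ω, the 2-cocycle λ∘f_μ on L/H satisfies (λ∘f_μ)(x,y) = 0 whenever [x,y] = 0 in L/H (equivalently, its cohomology class lies in B₀(L/H)) if and only if λ vanishes on T. -/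
variable (Ω : Type*) [Field Ω] (L : Type*) [LieRing L] [LieAlgebra Ω L]

/-- **Transgression criterion (Lemma on `B₀`).**
Let `H` be a central ideal of a finite-dimensional Lie algebra `L`, let
`T = ⟨K(L) ∩ H⟩`, let `μ` be a linear section of `π : L → L/H`, and let
`f_μ(x,y) = ⁅μ x, μ y⁆ - μ ⁅x,y⁆ ∈ H`.  Then for a linear `λ : H → Ω`, the
2-cocycle `λ ∘ f_μ` vanishes on all commuting pairs of `L/H` (that is, its class
lies in `B₀(L/H)`) if and only if `λ` vanishes on `T`. -/
theorem transgression_mem_B0_iff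
    (Ω : Type*) [Field Ω] (L : Type*) [LieRing L] [LieAlgebra Ω L] [FiniteDimensional Ω L]
    (H : LieIdeal Ω L) (hH : H ≤ LieAlgebra.center Ω L)
    (μ : (L ⧸ H) →ₗ[Ω] L)
    (hμ : ∀ x : L ⧸ H, LieSubmodule.Quotient.mk (N := H) (μ x) = x)
    (hmem : ∀ x y : L ⧸ H, ⁅μ x, μ y⁆ - μ ⁅x, y⁆ ∈ H)
    (lam : ↥H →ₗ[Ω] Ω) :
    (∀ x y : L ⧸ H, ⁅x, y⁆ = 0 → lam ⟨⁅μ x, μ y⁆ - μ ⁅x, y⁆, hmem x y⟩ = 0) ↔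
      (∀ h : ↥H, (h : L) ∈ Submodule.span Ω (bracketSet L ∩ (H : Set L)) → lam h = 0) := by
  have hz : ∀ u ∈ H, ∀ v : L, ⁅v, u⁆ = 0 := fun u hu v => by
    have h1 := hH hu
    rw [LieModule.mem_maxTrivSubmodule] at h1
    exact h1 v
  constructor
  · intro h0
    have key : Submodule.span Ω (bracketSet L ∩ (H : Set L)) ≤
        (LinearMap.ker lam).map H.toSubmodule.subtype := by
      rw [Submodule.span_le]
      rintro z ⟨⟨a, b, rfl⟩, hab⟩
      refine ⟨⟨⁅a, b⁆, hab⟩, ?_, rfl⟩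
      have hxy : ⁅(LieSubmodule.Quotient.mk (N := H) a : L ⧸ H),
          (LieSubmodule.Quotient.mk (N := H) b : L ⧸ H)⁆ = 0 := by
        rw [← LieSubmodule.Quotient.mk_bracket]
        exact (LieSubmodule.Quotient.mk_eq_zero (N := H)).2 hab
      have h1 := h0 _ _ hxy
      have hd : ∀ c : L, μ (LieSubmodule.Quotient.mk (N := H) c) - c ∈ H := fun c =>
        (Submodule.Quotient.eq H.toSubmodule).1 (hμ (LieSubmodule.Quotient.mk (N := H) c))
      have ha := hd a
      have hb := hd b
      have e : ⁅μ (LieSubmodule.Quotient.mk (N := H) a),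
          μ (LieSubmodule.Quotient.mk (N := H) b)⁆ = ⁅a, b⁆ := by
        have e1 := hz _ hb (μ (LieSubmodule.Quotient.mk (N := H) a))
        have e2 := hz _ ha b
        rw [lie_sub, sub_eq_zero] at e1 e2
        rw [e1, ← lie_skew, e2, lie_skew]
      have e3 : (⟨_, hmem (LieSubmodule.Quotient.mk (N := H) a)
          (LieSubmodule.Quotient.mk (N := H) b)⟩ : H) = ⟨⁅a, b⁆, hab⟩ := by
        apply Subtype.ext
        change _ - _ = _
        rw [hxy, map_zero, sub_zero, e]
      rw [e3] at h1
      exact h1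
    intro h hh
    obtain ⟨k, hk, hkh⟩ := key hh
    have : k = h := Subtype.ext hkh
    rw [← this]
    exact hk
  · intro h0 x y hxy
    apply h0
    apply Submodule.subset_span
    refine ⟨⟨μ x, μ y, ?_⟩, hmem x y⟩
    change _ - _ = _
    rw [hxy, map_zero, sub_zero]
end

section
/- Let L be a finite-dimensional Lie algebra over a field Ω, H a central ideal of L, T = ⟨K(L) ∩ H⟩, and μ : L/H → L a linear section of the projection π : L → L/H. Write Hom(L,Ω) for the space of Lie algebra homomorphisms L → Ω (Ω abelian), Hom_T(H,Ω) for the space of linear maps H → Ω vanishing on T, Inf : Hom(L/H,Ω) → Hom(L,Ω) for precomposition with π, Res : Hom(L,Ω) → Hom_T(H,Ω) for restriction to H, tra : Hom_T(H,Ω) → B₀(L/H) for λ ↦ [λ∘f_μ] where f_μ(x,y) = [μ(x),μ(y)] − μ([x,y]), and inf : B₀(L/H) → B₀(L) for the inflation [g] ↦ [g∘(π×π)]. Then the sequence 0 → Hom(L/H,Ω) → Hom(L,Ω) → Hom_T(H,Ω) → B₀(L/H) → B₀(L) is exact: Inf is injective, the image of Inf equals the kernel of Res, the image of Res equals the kernel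 of tra, and the image of tra equals the kernel of inf. -/
variable (Ω : Type*) [Field Ω] (L : Type*) [LieRing L] [LieAlgebra Ω L]

/-- **The five-term exact sequence for `B₀`.**
Let `H` be a central ideal of the finite-dimensional Lie algebra `L`,
`T = ⟨K(L) ∩ H⟩`, `π : L → L/H` the projection, `μ` a linear section of `π` and
`f_μ(x,y) = ⁅μ x, μ y⁆ - μ ⁅x,y⁆ ∈ H`.  Identifying Lie algebra homomorphisms into
the abelian Lie algebra `Ω` with linear maps vanishing on brackets, the sequence
`0 → Hom(L/H,Ω) → Hom(L,Ω) → Hom_T(H,Ω) → B₀(L/H) → B₀(L)` is exact, where the maps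
are inflation (precomposition with `π`), restriction to `H`, the transgression
`λ ↦ [λ ∘ f_μ]` and the inflation `[g] ↦ [g ∘ (π × π)]`.  Exactness is expressed here
elementwise on (classes of) cocycles. -/
theorem five_term_exact_sequence_B0
    (Ω : Type*) [Field Ω] (L : Type*) [LieRing L] [LieAlgebra Ω L] [FiniteDimensional Ω L]
    (H : LieIdeal Ω L) (hH : H ≤ LieAlgebra.center Ω L)
    (μ : (L ⧸ H) →ₗ[Ω] L)
    (hμ : ∀ x : L ⧸ H, LieSubmodule.Quotient.mk (N := H) (μ x) = x)
    (hmem : ∀ x y : L ⧸ H, ⁅μ x, μ y⁆ - μ ⁅x, y⁆ ∈ H) :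
    -- (1) `Inf : Hom(L/H, Ω) → Hom(L, Ω)` is injective
    (∀ g₁ g₂ : (L ⧸ H) →ₗ[Ω] Ω,
      (∀ x y : L ⧸ H, g₁ ⁅x, y⁆ = 0) → (∀ x y : L ⧸ H, g₂ ⁅x, y⁆ = 0) →
      (∀ l : L, g₁ (LieSubmodule.Quotient.mk (N := H) l) =
        g₂ (LieSubmodule.Quotient.mk (N := H) l)) → g₁ = g₂) ∧
    -- (2) image of `Inf` = kernel of `Res : Hom(L, Ω) → Hom_T(H, Ω)`
    (∀ g : L →ₗ[Ω] Ω, (∀ x y : L, g ⁅x, y⁆ = 0) →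
      ((∀ h : ↥H, g (h : L) = 0) ↔
        ∃ g' : (L ⧸ H) →ₗ[Ω] Ω, (∀ x y : L ⧸ H, g' ⁅x, y⁆ = 0) ∧
          ∀ l : L, g l = g' (LieSubmodule.Quotient.mk (N := H) l))) ∧
    -- (3) image of `Res` = kernel of `tra : Hom_T(H, Ω) → B₀(L/H)`
    (∀ lam : ↥H →ₗ[Ω] Ω,
      (∀ h : ↥H, (h : L) ∈ Submodule.span Ω (bracketSet L ∩ (H : Set L)) → lam h = 0) →
      (IsTwoCoboundary Ω (L ⧸ H)
          (fun x y : L ⧸ H => lam ⟨⁅μ x, μ y⁆ - μ ⁅x, y⁆, hmem x y⟩) ↔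
        ∃ g : L →ₗ[Ω] Ω, (∀ x y : L, g ⁅x, y⁆ = 0) ∧ ∀ h : ↥H, lam h = g (h : L))) ∧
    -- (4) image of `tra` = kernel of `inf : B₀(L/H) → B₀(L)`
    (∀ g : (L ⧸ H) → (L ⧸ H) → Ω, g ∈ twoCocycles Ω (L ⧸ H) →
      (∀ x y : L ⧸ H, ⁅x, y⁆ = 0 → g x y = 0) →
      (IsTwoCoboundary Ω L
          (fun a b : L => g (LieSubmodule.Quotient.mk (N := H) a)
            (LieSubmodule.Quotient.mk (N := H) b)) ↔
        ∃ lam : ↥H →ₗ[Ω] Ω,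
          (∀ h : ↥H, (h : L) ∈ Submodule.span Ω (bracketSet L ∩ (H : Set L)) → lam h = 0) ∧
          IsTwoCoboundary Ω (L ⧸ H)
            (fun x y : L ⧸ H => g x y - lam ⟨⁅μ x, μ y⁆ - μ ⁅x, y⁆, hmem x y⟩))) := by
  classical
  let π : L →ₗ[Ω] (L ⧸ H) := (LieSubmodule.Quotient.mk' H : L →ₗ⁅Ω, L⁆ L ⧸ H).toLinearMap
  have hπ : ∀ l : L, (LieSubmodule.Quotient.mk (N := H) l : L ⧸ H) = π l := fun l => rfl
  have hπb : ∀ a b : L, π ⁅a, b⁆ = ⁅π a, π b⁆ := fun a b =>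
    LieSubmodule.Quotient.mk_bracket H a b
  have hπ0 : ∀ l : L, π l = 0 ↔ l ∈ H := fun l =>
    LieSubmodule.Quotient.mk_eq_zero' (N := H)
  have hπμ : ∀ x, π (μ x) = x := hμ
  simp only [hπ]
  have hp : ∀ l : L, l - μ (π l) ∈ H := by
    intro l
    rw [← hπ0, map_sub, hπμ, sub_self]
  let p : L →ₗ[Ω] H :=
    { toFun := fun l => ⟨l - μ (π l), hp l⟩
      map_add' := by
        intro a b
        apply Subtype.ext
        simp only [map_add, LieSubmodule.coe_add]
        abel
      map_smul' := by
        intro c a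
        apply Subtype.ext
        simp only [map_smul, LieSubmodule.coe_smul, RingHom.id_apply, smul_sub] }
  have hpH : ∀ h : H, p (h : L) = h := by
    intro h
    apply Subtype.ext
    change (h : L) - μ (π h) = h
    rw [(hπ0 _).2 h.2, map_zero, sub_zero]
  have hcen : ∀ h ∈ H, ∀ a : L, ⁅a, h⁆ = 0 := fun h hh a => hH hh a
  have hcen' : ∀ h ∈ H, ∀ a : L, ⁅h, a⁆ = 0 := fun h hh a => by
    rw [← lie_skew, hcen h hh, neg_zero]
  have hbr : ∀ a b : L, ⁅μ (π a), μ (π b)⁆ = ⁅a, b⁆ := by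
    intro a b
    have h1 := hcen' _ (hp a) b
    have h2 := hcen _ (hp b) (μ (π a))
    rw [sub_lie, sub_eq_zero] at h1
    rw [lie_sub, sub_eq_zero] at h2
    rw [h1, h2]
  have hpb : ∀ a b : L,
      (⟨⁅μ (π a), μ (π b)⁆ - μ ⁅π a, π b⁆, hmem _ _⟩ : H) = p ⁅a, b⁆ := by
    intro a b
    apply Subtype.ext
    change ⁅μ (π a), μ (π b)⁆ - μ ⁅π a, π b⁆ = ⁅a, b⁆ - μ (π ⁅a, b⁆)
    rw [hbr, hπb]
  refine ⟨?_, ?_, ?_, ?_⟩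
  · intro g₁ g₂ _ _ h
    ext x
    rw [← hπμ x]
    exact h _
  · intro g hg
    constructor
    · intro h
      have key : ∀ l, g l = g (μ (π l)) := by
        intro l
        have := h ⟨_, hp l⟩
        rw [map_sub, sub_eq_zero] at this
        exact this
      refine ⟨g.comp μ, fun x y => ?_, fun l => key l⟩
      have := key ⁅μ x, μ y⁆
      rw [hπb, hπμ, hπμ, hg] at this
      exact this.symm
    · rintro ⟨g', _, h⟩ k
      rw [h, (hπ0 _).2 k.2, map_zero]
  · intro lam _
    constructor
    · rintro ⟨σ, hσ⟩
      refine ⟨lam.comp p + σ.comp π, fun a b => ?_, fun h => ?_⟩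
      · have := hσ (π a) (π b)
        simp only [hpb] at this
        simp only [LinearMap.add_apply, LinearMap.comp_apply, this, hπb, neg_add_cancel]
      · simp only [LinearMap.add_apply, LinearMap.comp_apply, hpH, (hπ0 _).2 h.2, map_zero,
          add_zero]
    · rintro ⟨g, hg, h⟩
      refine ⟨g.comp μ, fun x y => ?_⟩
      simp only [h, map_sub, hg, zero_sub, LinearMap.comp_apply]
  · intro g _ hg0
    constructor
    · rintro ⟨σ, hσ⟩
      refine ⟨-(σ.comp (H : Submodule Ω L).subtype), fun h hh => ?_, σ.comp μ, fun x y => ?_⟩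
      · have : Submodule.span Ω (bracketSet L ∩ (H : Set L)) ≤ LinearMap.ker σ := by
          rw [Submodule.span_le]
          rintro _ ⟨⟨a, b, rfl⟩, hab⟩
          have h0 : ⁅π a, π b⁆ = 0 := by
            rw [← hπb, hπ0]
            exact hab
          have h1 := hσ a b
          simp only [hg0 _ _ h0] at h1
          exact neg_eq_zero.1 h1.symm
        have h2 : σ (h : L) = 0 := this hh
        change -(σ (h : L)) = 0
        rw [h2, neg_zero]
      · have h1 := hσ (μ x) (μ y)
        simp only [hπμ] at h1
        change g x y - -(σ (⁅μ x, μ y⁆ - μ ⁅x, y⁆)) = -σ (μ ⁅x, y⁆)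
        rw [h1, map_sub]
        ring
    · rintro ⟨lam, _, τ, hτ⟩
      refine ⟨τ.comp π - lam.comp p, fun a b => ?_⟩
      have := hτ (π a) (π b)
      simp only [hpb] at this
      simp only [LinearMap.sub_apply, LinearMap.comp_apply, hπb]
      linear_combination this
end

section
/- Let L* be a finite-dimensional Lie algebra over a field Ω and A an ideal of L* with A ⊆ Z(L*) ∩ [L*,L*] and dim_Ω A = dim_Ω H²(L*/A, Ω) (so that L* is a cover of L = L*/A). Let T = ⟨K(L*) ∩ A⟩ and let μ : L*/A → L* be a linear section of the projection. Then the transgression map tra : Hom_T(A,Ω) → B₀(L*/A), sending a linear map λ : A → Ω vanishing on T to the class of the 2-cocycle (x,y) ↦ λ([μ(x),μ(y)] − μ([x,y])), is bijective. -/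
variable (Ω : Type*) [Field Ω] (L : Type*) [LieRing L] [LieAlgebra Ω L]

section Transgression

/-- The Jacobi identity in the form `⁅⁅a,b⁆,c⁆ + ⁅⁅b,c⁆,a⁆ + ⁅⁅c,a⁆,b⁆ = 0`. -/
theorem lie_lie_jacobi {A : Type*} [LieRing A] (a b c : A) :
    ⁅⁅a, b⁆, c⁆ + ⁅⁅b, c⁆, a⁆ + ⁅⁅c, a⁆, b⁆ = 0 := by
  have h := lie_jacobi a b c
  have e1 : ⁅⁅a, b⁆, c⁆ = -⁅c, ⁅a, b⁆⁆ := by rw [← lie_skew c ⁅a, b⁆, neg_neg]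
  have e2 : ⁅⁅b, c⁆, a⁆ = -⁅a, ⁅b, c⁆⁆ := by rw [← lie_skew a ⁅b, c⁆, neg_neg]
  have e3 : ⁅⁅c, a⁆, b⁆ = -⁅b, ⁅c, a⁆⁆ := by rw [← lie_skew b ⁅c, a⁆, neg_neg]
  rw [e1, e2, e3, ← neg_add, ← neg_add, neg_eq_zero, add_rotate]
  exact h

variable {Ω : Type*} [Field Ω] {L : Type*} [LieRing L] [LieAlgebra Ω L]

/-- The 2-cocycle `λ ∘ f_μ` on `L/H` obtained from a linear map `λ : H → Ω` and the
factor set `f_μ(x,y) = ⁅μ x, μ y⁆ - μ ⁅x,y⁆` of a linear section `μ` of `L → L/H`. -/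
def traCocycle (H : LieIdeal Ω L) (μ : (L ⧸ H) →ₗ[Ω] L)
    (hmem : ∀ x y : L ⧸ H, ⁅μ x, μ y⁆ - μ ⁅x, y⁆ ∈ H) (lam : ↥H →ₗ[Ω] Ω) :
    (L ⧸ H) → (L ⧸ H) → Ω :=
  fun x y => lam ⟨⁅μ x, μ y⁆ - μ ⁅x, y⁆, hmem x y⟩

/-- For a central ideal `H`, `λ ∘ f_μ` is a 2-cocycle on `L/H`. -/
theorem traCocycle_mem_twoCocycles (H : LieIdeal Ω L) (hH : H ≤ LieAlgebra.center Ω L)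
    (μ : (L ⧸ H) →ₗ[Ω] L)
    (hμ : ∀ x : L ⧸ H, LieSubmodule.Quotient.mk (N := H) (μ x) = x)
    (hmem : ∀ x y : L ⧸ H, ⁅μ x, μ y⁆ - μ ⁅x, y⁆ ∈ H) (lam : ↥H →ₗ[Ω] Ω) :
    traCocycle H μ hmem lam ∈ twoCocycles Ω (L ⧸ H) := by
  have hcent : ∀ a : L, a ∈ H → ∀ b : L, ⁅a, b⁆ = 0 := by
    intro a ha b
    have h := (LieModule.mem_maxTrivSubmodule Ω L L a).mp (hH ha) b
    rw [← lie_skew, h, neg_zero]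
  refine ⟨?_, ?_, ?_, ?_, ?_, ?_⟩
  · intro x x' y
    have e : (⟨⁅μ (x + x'), μ y⁆ - μ ⁅x + x', y⁆, hmem _ _⟩ : ↥H)
        = ⟨⁅μ x, μ y⁆ - μ ⁅x, y⁆, hmem _ _⟩ + ⟨⁅μ x', μ y⁆ - μ ⁅x', y⁆, hmem _ _⟩ :=
      Subtype.ext (by simp only [LieSubmodule.coe_add, map_add, add_lie]; abel)
    show lam _ = lam _ + lam _
    rw [e, map_add]
  · intro x y y'
    have e : (⟨⁅μ x, μ (y + y')⁆ - μ ⁅x, y + y'⁆, hmem _ _⟩ : ↥H)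
        = ⟨⁅μ x, μ y⁆ - μ ⁅x, y⁆, hmem _ _⟩ + ⟨⁅μ x, μ y'⁆ - μ ⁅x, y'⁆, hmem _ _⟩ :=
      Subtype.ext (by simp only [LieSubmodule.coe_add, map_add, lie_add]; abel)
    show lam _ = lam _ + lam _
    rw [e, map_add]
  · intro a x y
    have e : (⟨⁅μ (a • x), μ y⁆ - μ ⁅a • x, y⁆, hmem _ _⟩ : ↥H)
        = a • ⟨⁅μ x, μ y⁆ - μ ⁅x, y⁆, hmem _ _⟩ :=
      Subtype.ext (by simp only [SetLike.val_smul, map_smul, smul_lie, smul_sub])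
    show lam _ = _ * lam _
    rw [e, map_smul, smul_eq_mul]
  · intro a x y
    have e : (⟨⁅μ x, μ (a • y)⁆ - μ ⁅x, a • y⁆, hmem _ _⟩ : ↥H)
        = a • ⟨⁅μ x, μ y⁆ - μ ⁅x, y⁆, hmem _ _⟩ :=
      Subtype.ext (by simp only [SetLike.val_smul, map_smul, lie_smul, smul_sub])
    show lam _ = _ * lam _
    rw [e, map_smul, smul_eq_mul]
  · intro x
    have e : (⟨⁅μ x, μ x⁆ - μ ⁅x, x⁆, hmem _ _⟩ : ↥H) = 0 := Subtype.ext (by simp)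
    show lam _ = 0
    rw [e, map_zero]
  · intro x y z
    have key : ∀ u v : L ⧸ H, ∀ c : L, ⁅μ ⁅u, v⁆, c⁆ = ⁅⁅μ u, μ v⁆, c⁆ := by
      intro u v c
      have h1 : ⁅⁅μ u, μ v⁆ - μ ⁅u, v⁆, c⁆ = 0 := hcent _ (hmem u v) c
      rw [sub_lie, sub_eq_zero] at h1
      exact h1.symm
    have jac : ⁅⁅x, y⁆, z⁆ + ⁅⁅y, z⁆, x⁆ + ⁅⁅z, x⁆, y⁆ = (0 : L ⧸ H) :=
      lie_lie_jacobi x y z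
    have e : (⟨⁅μ ⁅x, y⁆, μ z⁆ - μ ⁅⁅x, y⁆, z⁆, hmem _ _⟩ : ↥H)
        + ⟨⁅μ ⁅y, z⁆, μ x⁆ - μ ⁅⁅y, z⁆, x⁆, hmem _ _⟩
        + ⟨⁅μ ⁅z, x⁆, μ y⁆ - μ ⁅⁅z, x⁆, y⁆, hmem _ _⟩ = 0 := by
      apply Subtype.ext
      simp only [LieSubmodule.coe_add, LieSubmodule.coe_zero]
      rw [key x y (μ z), key y z (μ x), key z x (μ y)]
      have h2 : μ ⁅⁅x, y⁆, z⁆ + μ ⁅⁅y, z⁆, x⁆ + μ ⁅⁅z, x⁆, y⁆ = 0 := by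
        rw [← map_add, ← map_add, jac, map_zero]
      have h1 : ⁅⁅μ x, μ y⁆, μ z⁆ + ⁅⁅μ y, μ z⁆, μ x⁆ + ⁅⁅μ z, μ x⁆, μ y⁆ = (0 : L) :=
        lie_lie_jacobi _ _ _
      have comb : (⁅⁅μ x, μ y⁆, μ z⁆ - μ ⁅⁅x, y⁆, z⁆) + (⁅⁅μ y, μ z⁆, μ x⁆ - μ ⁅⁅y, z⁆, x⁆)
          + (⁅⁅μ z, μ x⁆, μ y⁆ - μ ⁅⁅z, x⁆, y⁆)
          = (⁅⁅μ x, μ y⁆, μ z⁆ + ⁅⁅μ y, μ z⁆, μ x⁆ + ⁅⁅μ z, μ x⁆, μ y⁆)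
            - (μ ⁅⁅x, y⁆, z⁆ + μ ⁅⁅y, z⁆, x⁆ + μ ⁅⁅z, x⁆, y⁆) := by abel
      rw [comb, h1, h2, sub_zero]
    show lam _ + lam _ + lam _ = 0
    rw [← map_add, ← map_add, e, map_zero]

/-- If moreover `λ` vanishes on `T = ⟨K(L) ∩ H⟩`, the class of `λ ∘ f_μ` lies in
`B₀(L/H)`; this is the transgression map `tra : Hom_T(H,Ω) → B₀(L/H)`. -/
theorem traCocycle_class_mem_B0 (H : LieIdeal Ω L) (hH : H ≤ LieAlgebra.center Ω L)
    (μ : (L ⧸ H) →ₗ[Ω] L)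
    (hμ : ∀ x : L ⧸ H, LieSubmodule.Quotient.mk (N := H) (μ x) = x)
    (hmem : ∀ x y : L ⧸ H, ⁅μ x, μ y⁆ - μ ⁅x, y⁆ ∈ H) (lam : ↥H →ₗ[Ω] Ω)
    (hlam : ∀ h : ↥H, (h : L) ∈ Submodule.span Ω (bracketSet L ∩ (H : Set L)) → lam h = 0) :
    H2class Ω (L ⧸ H) (traCocycle H μ hmem lam)
      (traCocycle_mem_twoCocycles H hH μ hμ hmem lam) ∈ B0 Ω (L ⧸ H) := by
  refine ⟨⟨traCocycle H μ hmem lam, traCocycle_mem_twoCocycles H hH μ hμ hmem lam⟩, ?_, rfl⟩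
  show traCocycle H μ hmem lam ∈ vanishingOnCommuting Ω (L ⧸ H)
  intro x y hxy
  have hb : ⁅μ x, μ y⁆ ∈ H := by
    have h := hmem x y
    rwa [hxy, map_zero, sub_zero] at h
  apply hlam
  show ⁅μ x, μ y⁆ - μ ⁅x, y⁆ ∈ _
  rw [hxy, map_zero, sub_zero]
  exact Submodule.subset_span ⟨⟨μ x, μ y, rfl⟩, hb⟩

end Transgression

/-- The transgression on all of `Hom(A, Ω)`, as a linear map into `H²`. -/
noncomputable def traLin {Ω : Type*} [Field Ω] {K : Type*} [LieRing K] [LieAlgebra Ω K]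
    (A : LieIdeal Ω K) (hZ : A ≤ LieAlgebra.center Ω K)
    (μ : (K ⧸ A) →ₗ[Ω] K)
    (hμ : ∀ x : K ⧸ A, LieSubmodule.Quotient.mk (N := A) (μ x) = x)
    (hmem : ∀ x y : K ⧸ A, ⁅μ x, μ y⁆ - μ ⁅x, y⁆ ∈ A) :
    (↥A →ₗ[Ω] Ω) →ₗ[Ω] lieH2 Ω (K ⧸ A) :=
  (twoCoboundariesIn Ω (K ⧸ A)).mkQ ∘ₗ
    { toFun := fun lam => ⟨traCocycle A μ hmem lam,
        traCocycle_mem_twoCocycles A hZ μ hμ hmem lam⟩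
      map_add' := fun _ _ => rfl
      map_smul' := fun _ _ => rfl }

/-- 2-cocycles as bilinear maps. -/
def cocycleToBilin (Ω : Type*) [Field Ω] (L : Type*) [LieRing L] [LieAlgebra Ω L] :
    twoCocycles Ω L →ₗ[Ω] (L →ₗ[Ω] L →ₗ[Ω] Ω) where
  toFun f := LinearMap.mk₂ Ω f.1 f.2.1 f.2.2.2.1 f.2.2.1 f.2.2.2.2.1
  map_add' _ _ := rfl
  map_smul' _ _ := rfl

theorem finite_lieH2 (Ω : Type*) [Field Ω] (L : Type*) [LieRing L] [LieAlgebra Ω L]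
    [FiniteDimensional Ω L] : FiniteDimensional Ω (lieH2 Ω L) := by
  have hinj : Function.Injective (cocycleToBilin Ω L) := by
    intro f g h
    apply Subtype.ext
    funext x y
    exact LinearMap.congr_fun (LinearMap.congr_fun h x) y
  have : FiniteDimensional Ω (twoCocycles Ω L) :=
    Module.Finite.of_injective (cocycleToBilin Ω L) hinj
  infer_instance

/-- Brackets in `K` only depend on the classes modulo a central ideal. -/
theorem lie_eq_lie_section {Ω : Type*} [Field Ω] {K : Type*} [LieRing K] [LieAlgebra Ω K]
    (A : LieIdeal Ω K) (hZ : A ≤ LieAlgebra.center Ω K)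
    (μ : (K ⧸ A) →ₗ[Ω] K)
    (hμ : ∀ x : K ⧸ A, LieSubmodule.Quotient.mk (N := A) (μ x) = x) (k l : K) :
    ⁅k, l⁆ = ⁅μ (LieSubmodule.Quotient.mk (N := A) k),
      μ (LieSubmodule.Quotient.mk (N := A) l)⁆ := by
  have hsub : ∀ k : K, k - μ (LieSubmodule.Quotient.mk (N := A) k) ∈ A := by
    intro k
    exact (Submodule.Quotient.eq _).mp (hμ (LieSubmodule.Quotient.mk (N := A) k)).symm
  have hr : ∀ a ∈ A, ∀ b : K, ⁅b, a⁆ = 0 := fun a ha b =>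
    (LieModule.mem_maxTrivSubmodule Ω K K a).mp (hZ ha) b
  have hl : ∀ a ∈ A, ∀ b : K, ⁅a, b⁆ = 0 := fun a ha b => by
    rw [← lie_skew, hr a ha b, neg_zero]
  have h1 := hl _ (hsub k) l
  rw [sub_lie, sub_eq_zero] at h1
  have h2 := hr _ (hsub l) (μ (LieSubmodule.Quotient.mk (N := A) k))
  rw [lie_sub, sub_eq_zero] at h2
  rw [h1, h2]

theorem traLin_injective {Ω : Type*} [Field Ω] {K : Type*} [LieRing K] [LieAlgebra Ω K]
    (A : LieIdeal Ω K) (hZ : A ≤ LieAlgebra.center Ω K)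
    (hD : A ≤ LieAlgebra.derivedSeries Ω K 1)
    (μ : (K ⧸ A) →ₗ[Ω] K)
    (hμ : ∀ x : K ⧸ A, LieSubmodule.Quotient.mk (N := A) (μ x) = x)
    (hmem : ∀ x y : K ⧸ A, ⁅μ x, μ y⁆ - μ ⁅x, y⁆ ∈ A) :
    Function.Injective (traLin A hZ μ hμ hmem) := by
  rw [← LinearMap.ker_eq_bot, LinearMap.ker_eq_bot']
  intro lam h0
  have hcob : IsTwoCoboundary Ω (K ⧸ A) (traCocycle A μ hmem lam) :=
    (Submodule.Quotient.mk_eq_zero (twoCoboundariesIn Ω (K ⧸ A))).mp h0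
  obtain ⟨σ, hσ⟩ := hcob
  have hsub : ∀ k : K, k - μ (LieSubmodule.Quotient.mk (N := A) k) ∈ A := by
    intro k
    exact (Submodule.Quotient.eq _).mp (hμ (LieSubmodule.Quotient.mk (N := A) k)).symm
  let π : K →ₗ[Ω] K ⧸ A := A.toSubmodule.mkQ
  let p : K →ₗ[Ω] ↥A :=
    LinearMap.codRestrict A.toSubmodule (LinearMap.id - μ ∘ₗ π) hsub
  let φ : K →ₗ[Ω] Ω := lam ∘ₗ p + σ ∘ₗ π
  have hφ : ∀ k l : K, φ ⁅k, l⁆ = 0 := by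
    intro k l
    have hπ : π ⁅k, l⁆ = ⁅π k, π l⁆ := LieSubmodule.Quotient.mk_bracket A k l
    have hp : p ⁅k, l⁆ = ⟨⁅μ (π k), μ (π l)⁆ - μ ⁅π k, π l⁆, hmem _ _⟩ := by
      apply Subtype.ext
      change ⁅k, l⁆ - μ (π ⁅k, l⁆) = _
      rw [hπ, lie_eq_lie_section A hZ μ hμ k l]
      rfl
    have h := hσ (π k) (π l)
    change lam (p ⁅k, l⁆) + σ (π ⁅k, l⁆) = 0
    rw [hp, hπ]
    change lam _ = _ at h
    rw [h, neg_add_cancel]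
  have hker : ∀ k ∈ LieAlgebra.derivedSeries Ω K 1, φ k = 0 := by
    intro k hk
    have hk' : k ∈ Submodule.span Ω {m : K | ∃ x y : K, ⁅x, y⁆ = m} := by
      rw [LieAlgebra.derivedSeries_def, LieAlgebra.derivedSeriesOfIdeal_succ,
        LieAlgebra.derivedSeriesOfIdeal_zero, ← LieSubmodule.mem_toSubmodule,
        LieSubmodule.lieIdeal_oper_eq_linear_span'] at hk
      refine Submodule.span_mono ?_ hk
      rintro m ⟨x, -, y, -, h⟩
      exact ⟨x, y, h⟩
    have hle : Submodule.span Ω {m : K | ∃ x y : K, ⁅x, y⁆ = m} ≤ LinearMap.ker φ := by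
      rw [Submodule.span_le]
      rintro _ ⟨x, y, rfl⟩
      exact hφ x y
    exact hle hk'
  ext a
  have h := hker a (hD a.2)
  have hπ : π (a : K) = 0 := (Submodule.Quotient.mk_eq_zero A.toSubmodule).mpr a.2
  have hp : p (a : K) = a := by
    apply Subtype.ext
    change (a : K) - μ (π a) = a
    rw [hπ, map_zero, sub_zero]
  change lam (p a) + σ (π a) = 0 at h
  rw [hp, hπ, map_zero, add_zero] at h
  simpa using h

/-- **Bijectivity of the transgression for a cover.**
Let `L*` be a finite-dimensional Lie algebra, `A` an ideal with
`A ⊆ Z(L*) ∩ [L*,L*]` and `dim A = dim H²(L*/A, Ω)` (so `L*` is a cover of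
`L = L*/A`), `T = ⟨K(L*) ∩ A⟩`, and `μ` a linear section of `L* → L*/A`.  Then the
transgression `tra : Hom_T(A,Ω) → B₀(L*/A)`, `λ ↦ [λ ∘ f_μ]`, is bijective. -/
theorem transgression_bijective_of_cover
    (Ω : Type*) [Field Ω] (K : Type*) [LieRing K] [LieAlgebra Ω K] [FiniteDimensional Ω K]
    (A : LieIdeal Ω K)
    (hZ : A ≤ LieAlgebra.center Ω K) (hD : A ≤ LieAlgebra.derivedSeries Ω K 1)
    (hdim : Module.finrank Ω ↥A = Module.finrank Ω (lieH2 Ω (K ⧸ A)))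
    (μ : (K ⧸ A) →ₗ[Ω] K)
    (hμ : ∀ x : K ⧸ A, LieSubmodule.Quotient.mk (N := A) (μ x) = x)
    (hmem : ∀ x y : K ⧸ A, ⁅μ x, μ y⁆ - μ ⁅x, y⁆ ∈ A) :
    Function.Bijective
      (fun lam : {lam : ↥A →ₗ[Ω] Ω //
          ∀ h : ↥A, (h : K) ∈ Submodule.span Ω (bracketSet K ∩ (A : Set K)) → lam h = 0} =>
        (⟨H2class Ω (K ⧸ A) (traCocycle A μ hmem lam.1)
            (traCocycle_mem_twoCocycles A hZ μ hμ hmem lam.1),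
          traCocycle_class_mem_B0 A hZ μ hμ hmem lam.1 lam.2⟩ : ↥(B0 Ω (K ⧸ A)))) := by
  have hinj := traLin_injective A hZ hD μ hμ hmem
  constructor
  · intro l₁ l₂ h
    apply Subtype.ext
    exact hinj (congrArg Subtype.val h)
  · rintro ⟨c, f, hf, rfl⟩
    have : FiniteDimensional Ω (K ⧸ A) :=
      inferInstanceAs (FiniteDimensional Ω (K ⧸ A.toSubmodule))
    have := finite_lieH2 Ω (K ⧸ A)
    have hfr : Module.finrank Ω (↥A →ₗ[Ω] Ω) = Module.finrank Ω (lieH2 Ω (K ⧸ A)) := by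
      rw [← hdim]
      exact Subspace.dual_finrank_eq
    obtain ⟨lam, hlam⟩ :=
      (LinearMap.injective_iff_surjective_of_finrank_eq_finrank hfr).mp hinj
        ((twoCoboundariesIn Ω (K ⧸ A)).mkQ f)
    have hcob : IsTwoCoboundary Ω (K ⧸ A) (traCocycle A μ hmem lam - f.1) :=
      (Submodule.Quotient.eq (twoCoboundariesIn Ω (K ⧸ A))).mp hlam
    obtain ⟨σ, hσ⟩ := hcob
    have hvan : ∀ x y : K ⧸ A, ⁅x, y⁆ = 0 → traCocycle A μ hmem lam x y = 0 := by
      intro x y hxy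
      have h := hσ x y
      have hfxy : f.1 x y = 0 := hf x y hxy
      rw [hxy, map_zero, neg_zero] at h
      change traCocycle A μ hmem lam x y - f.1 x y = 0 at h
      rwa [hfxy, sub_zero] at h
    refine ⟨⟨lam, ?_⟩, Subtype.ext hlam⟩
    have hle : Submodule.span Ω (bracketSet K ∩ (A : Set K)) ≤
        (LinearMap.ker lam).map A.toSubmodule.subtype := by
      rw [Submodule.span_le]
      rintro _ ⟨⟨k, l, rfl⟩, hkl⟩
      have hxy : ⁅(LieSubmodule.Quotient.mk k : K ⧸ A), (LieSubmodule.Quotient.mk l : K ⧸ A)⁆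
          = 0 := by
        rw [← LieSubmodule.Quotient.mk_bracket]
        exact (Submodule.Quotient.mk_eq_zero A.toSubmodule).mpr hkl
      refine ⟨⟨⁅k, l⁆, hkl⟩, ?_, rfl⟩
      have h := hvan _ _ hxy
      change lam _ = 0
      rw [← h]
      change lam _ = lam _
      congr 1
      apply Subtype.ext
      change ⁅k, l⁆ = _ - _
      rw [hxy, map_zero, sub_zero, lie_eq_lie_section A hZ μ hμ k l]
    intro h hh
    obtain ⟨a, ha, hah⟩ := hle hh
    have : a = h := Subtype.ext hah
    rw [← this]
    exact ha
end

section
/- Let L* be a finite-dimensional Lie algebra over a field Ω and A an ideal of L* with A ⊆ Z(L*) ∩ [L*,L*] and dim_Ω A = dim_Ω H²(L*/A, Ω). Then B₀(L*/A) is isomorphic as an Ω-vector space to the quotient A/⟨K(L*) ∩ A⟩. -/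
variable (Ω : Type*) [Field Ω] (L : Type*) [LieRing L] [LieAlgebra Ω L]

section Helpers

variable {Ω : Type*} [Field Ω] {K : Type*} [LieRing K] [LieAlgebra Ω K]

theorem lieH2_finite (L : Type*) [LieRing L] [LieAlgebra Ω L] [FiniteDimensional Ω L] :
    FiniteDimensional Ω (lieH2 Ω L) := by
  let φ : twoCocycles Ω L →ₗ[Ω] (L →ₗ[Ω] L →ₗ[Ω] Ω) :=
    { toFun := fun f => LinearMap.mk₂ Ω f.1 f.2.1 f.2.2.2.1 f.2.2.1 f.2.2.2.2.1
      map_add' := fun f g => by ext; rfl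
      map_smul' := fun c f => by ext; rfl }
  have hφ : Function.Injective φ := by
    intro f g h
    ext x y
    exact congrArg (fun b : L →ₗ[Ω] L →ₗ[Ω] Ω => b x y) h
  have : FiniteDimensional Ω (twoCocycles Ω L) := Module.Finite.of_injective φ hφ
  infer_instance

theorem exists_section (A : LieIdeal Ω K) : ∃ (s : (K ⧸ A) →ₗ[Ω] K)
    (r : K →ₗ[Ω] ↥(A : Submodule Ω K)),
    (∀ x, (LieSubmodule.Quotient.mk (s x) : K ⧸ A) = x) ∧
    (∀ k, (r k : K) = k - s (LieSubmodule.Quotient.mk k)) := by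
  let p : K →ₗ[Ω] (K ⧸ A) := (LieSubmodule.Quotient.mk' A : K →ₗ[Ω] (K ⧸ A))
  have hp : Function.Surjective p := LieSubmodule.Quotient.surjective_mk' A
  obtain ⟨s, hs⟩ := p.exists_rightInverse_of_surjective (LinearMap.range_eq_top.2 hp)
  have hs' : ∀ x, (LieSubmodule.Quotient.mk (s x) : K ⧸ A) = x := fun x =>
    LinearMap.congr_fun hs x
  refine ⟨s, LinearMap.codRestrict _ (LinearMap.id - s ∘ₗ p) ?_, hs', fun k => rfl⟩
  intro k
  change k - s (p k) ∈ A
  rw [← LieSubmodule.Quotient.mk_eq_zero]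
  change p (k - s (p k)) = 0
  rw [map_sub, sub_eq_zero]
  exact (hs' _).symm

theorem bracket_section {A : LieIdeal Ω K} (hA : A ≤ LieAlgebra.center Ω K)
    {k k' l l' : K} (h : (LieSubmodule.Quotient.mk k : K ⧸ A) = LieSubmodule.Quotient.mk k')
    (h' : (LieSubmodule.Quotient.mk l : K ⧸ A) = LieSubmodule.Quotient.mk l') :
    ⁅k, l⁆ = ⁅k', l'⁆ := by
  have h1 : k - k' ∈ LieAlgebra.center Ω K := hA ((Submodule.Quotient.eq _).1 h)
  have h2 : l - l' ∈ LieAlgebra.center Ω K := hA ((Submodule.Quotient.eq _).1 h')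
  rw [LieModule.mem_maxTrivSubmodule] at h1 h2
  have e1 := h1 l
  have e2 := h2 k'
  rw [lie_sub, sub_eq_zero] at e1 e2
  rw [← lie_skew, e1, lie_skew, e2]

theorem mk_lie (A : LieIdeal Ω K) (k l : K) :
    (LieSubmodule.Quotient.mk ⁅k, l⁆ : K ⧸ A)
      = ⁅(LieSubmodule.Quotient.mk k : K ⧸ A), (LieSubmodule.Quotient.mk l : K ⧸ A)⁆ := rfl

theorem mk_zero (A : LieIdeal Ω K) (k : K) :
    (LieSubmodule.Quotient.mk k : K ⧸ A) = 0 ↔ k ∈ A := LieSubmodule.Quotient.mk_eq_zero A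

theorem core [FiniteDimensional Ω K] (A : LieIdeal Ω K)
    (hA : A ≤ LieAlgebra.center Ω K ⊓ LieAlgebra.derivedSeries Ω K 1)
    (hdim : Module.finrank Ω ↥A = Module.finrank Ω (lieH2 Ω (K ⧸ A))) :
    ∃ e : Module.Dual Ω ↥(A : Submodule Ω K) ≃ₗ[Ω] lieH2 Ω (K ⧸ A),
      B0 Ω (K ⧸ A) = (((Submodule.span Ω (bracketSet K ∩ (A : Set K))).comap
          (A : Submodule Ω K).subtype).dualAnnihilator).map (e : _ →ₗ[Ω] _) := by
  have hc : A ≤ LieAlgebra.center Ω K := hA.trans inf_le_left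
  have hd : A ≤ LieAlgebra.derivedSeries Ω K 1 := hA.trans inf_le_right
  obtain ⟨s, r, hs, hr⟩ := exists_section A
  have hrA : ∀ a : ↥(A : Submodule Ω K), r a = a := by
    intro a
    ext
    rw [hr, (mk_zero A _).2 a.2]
    simp
  have hbr : ∀ k l : K, ⁅s (LieSubmodule.Quotient.mk k), s (LieSubmodule.Quotient.mk l)⁆ = ⁅k, l⁆ :=
    fun k l => bracket_section hc (hs _) (hs _)
  have hbr1 : ∀ x y z : K ⧸ A, ⁅s ⁅x, y⁆, s z⁆ = ⁅⁅s x, s y⁆, s z⁆ := fun x y z =>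
    bracket_section hc (by rw [hs, mk_lie, hs, hs]) rfl
  have hcoc : ∀ ψ : K →ₗ[Ω] Ω, (fun x y => ψ ⁅s x, s y⁆) ∈ twoCocycles Ω (K ⧸ A) := by
    intro ψ
    refine ⟨?_, ?_, ?_, ?_, ?_, ?_⟩
    · intros; simp
    · intros; simp
    · intros; simp
    · intros; simp
    · intros; simp
    · intro x y z
      beta_reduce
      rw [hbr1, hbr1, hbr1, ← map_add, ← map_add]
      have := lie_jacobi (s x) (s y) (s z)
      have h2 : ⁅⁅s x, s y⁆, s z⁆ + ⁅⁅s y, s z⁆, s x⁆ + ⁅⁅s z, s x⁆, s y⁆ = 0 := by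
        rw [← lie_skew ⁅s x, s y⁆, ← lie_skew ⁅s y, s z⁆, ← lie_skew ⁅s z, s x⁆,
          ← neg_eq_zero, ← this]
        abel
      rw [h2, map_zero]
  let T0 : Module.Dual Ω ↥(A : Submodule Ω K) →ₗ[Ω] twoCocycles Ω (K ⧸ A) :=
    { toFun := fun χ => ⟨fun x y => χ (r ⁅s x, s y⁆), hcoc (χ ∘ₗ r)⟩
      map_add' := fun f g => by ext; rfl
      map_smul' := fun c f => by ext; rfl }
  have hT0 : ∀ χ x y, (T0 χ).1 x y = χ (r ⁅s x, s y⁆) := fun _ _ _ => rfl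
  let T := (twoCoboundariesIn Ω (K ⧸ A)).mkQ ∘ₗ T0
  have hinj : Function.Injective T := by
    rw [← LinearMap.ker_eq_bot, LinearMap.ker_eq_bot']
    intro χ hχ
    have : T0 χ ∈ twoCoboundariesIn Ω (K ⧸ A) := (Submodule.Quotient.mk_eq_zero _).1 hχ
    obtain ⟨σ, hσ⟩ := this
    let F : K →ₗ[Ω] Ω := χ ∘ₗ r + σ ∘ₗ (LieSubmodule.Quotient.mk' A : K →ₗ[Ω] (K ⧸ A))
    have hF : ∀ k, F k = χ (r k) + σ (LieSubmodule.Quotient.mk k) := fun _ => rfl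
    have hF0 : ∀ k l : K, F ⁅k, l⁆ = 0 := by
      intro k l
      have := hσ (LieSubmodule.Quotient.mk k) (LieSubmodule.Quotient.mk l)
      change χ (r ⁅s (LieSubmodule.Quotient.mk k), s (LieSubmodule.Quotient.mk l)⁆) = _ at this
      rw [hbr] at this
      rw [hF, this, mk_lie]; simp
    have hder : (LieAlgebra.derivedSeries Ω K 1).toSubmodule
        ≤ LinearMap.ker F := by
      rw [LieAlgebra.derivedSeries_def, LieAlgebra.derivedSeriesOfIdeal_succ,
        LieSubmodule.lieIdeal_oper_eq_linear_span, Submodule.span_le]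
      rintro _ ⟨x, y, rfl⟩
      exact hF0 _ _
    ext a
    have h1 : F a = 0 := hder (hd a.2)
    rw [hF, (mk_zero A _).2 a.2, hrA] at h1
    change χ a = 0
    simpa using h1
  have : FiniteDimensional Ω (K ⧸ A) :=
    inferInstanceAs (FiniteDimensional Ω (K ⧸ (A : Submodule Ω K)))
  have := lieH2_finite (Ω := Ω) (K ⧸ A)
  have hfr : Module.finrank Ω (Module.Dual Ω ↥(A : Submodule Ω K))
      = Module.finrank Ω (lieH2 Ω (K ⧸ A)) := by
    rw [Subspace.dual_finrank_eq]; exact hdim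
  let e := LinearEquiv.ofInjectiveOfFinrankEq T hinj hfr
  have he : ∀ χ, e χ = T χ := fun χ => rfl
  refine ⟨e, ?_⟩
  have key : ∀ χ, T χ ∈ B0 Ω (K ⧸ A) ↔ χ ∈ ((Submodule.span Ω (bracketSet K ∩ (A : Set K))).comap
          (A : Submodule Ω K).subtype).dualAnnihilator := by
    intro χ
    rw [Submodule.mem_dualAnnihilator]
    constructor
    · rintro ⟨g, hg, hgT⟩
      have hgT' : g - T0 χ ∈ twoCoboundariesIn Ω (K ⧸ A) :=
        (Submodule.Quotient.eq _).1 hgT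
      obtain ⟨σ, hσ⟩ := hgT'
      have hsp : Submodule.span Ω (bracketSet K ∩ (A : Set K)) ≤ LinearMap.ker (χ ∘ₗ r) := by
        rw [Submodule.span_le]
        rintro _ ⟨⟨k, l, rfl⟩, hkl⟩
        have h0 : ⁅(LieSubmodule.Quotient.mk k : K ⧸ A), (LieSubmodule.Quotient.mk l : K ⧸ A)⁆ = 0 := by
          rw [← mk_lie]; exact (mk_zero A _).2 hkl
        have h1 := hσ (LieSubmodule.Quotient.mk k) (LieSubmodule.Quotient.mk l)
        change g.1 _ _ - χ (r ⁅s _, s _⁆) = _ at h1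
        have h2 : g.1 (LieSubmodule.Quotient.mk k) (LieSubmodule.Quotient.mk l) = 0 := hg _ _ h0
        rw [hbr, h0, h2] at h1
        change χ (r ⁅k, l⁆) = 0
        simpa using h1
      intro w hw
      have := hsp hw
      rw [LinearMap.mem_ker] at this
      change χ (r (w : K)) = 0 at this
      rwa [hrA] at this
    · intro h
      refine ⟨T0 χ, ?_, rfl⟩
      intro x y hxy
      change χ (r ⁅s x, s y⁆) = 0
      have hm : ⁅s x, s y⁆ ∈ A := by
        rw [← mk_zero, mk_lie, hs, hs, hxy]
      have := hrA ⟨_, hm⟩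
      rw [this]
      exact h _ (Submodule.subset_span ⟨⟨_, _, rfl⟩, hm⟩)
  ext c
  obtain ⟨χ, rfl⟩ := e.surjective c
  rw [he, key]
  constructor
  · intro h; exact ⟨χ, h, rfl⟩
  · rintro ⟨χ', h, h'⟩
    have : χ' = χ := e.injective h'
    exact this ▸ h

end Helpers

/-- If `L*` is a cover of `L = L*/A`, i.e. `A` is an ideal with
`A ⊆ Z(L*) ∩ [L*,L*]` and `dim A = dim H²(L*/A, Ω)`, then
`B₀(L*/A) ≅ A / ⟨K(L*) ∩ A⟩` as `Ω`-vector spaces. -/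
theorem bogomolov_of_cover
    (Ω : Type*) [Field Ω] (K : Type*) [LieRing K] [LieAlgebra Ω K] [FiniteDimensional Ω K]
    (A : LieIdeal Ω K)
    (hA : A ≤ LieAlgebra.center Ω K ⊓ LieAlgebra.derivedSeries Ω K 1)
    (hdim : Module.finrank Ω ↥A = Module.finrank Ω (lieH2 Ω (K ⧸ A))) :
    Nonempty (↥(B0 Ω (K ⧸ A)) ≃ₗ[Ω]
      (↥(A : Submodule Ω K) ⧸
        (Submodule.span Ω (bracketSet K ∩ (A : Set K))).comap
          (A : Submodule Ω K).subtype)) := by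
  obtain ⟨e, he⟩ := core A hA hdim
  refine ⟨?_⟩
  rw [he]
  set W := (Submodule.span Ω (bracketSet K ∩ (A : Set K))).comap (A : Submodule Ω K).subtype
  have e1 := e.submoduleMap W.dualAnnihilator
  have e2 := W.dualQuotEquivDualAnnihilator
  have e3 : Module.Dual Ω (↥(A : Submodule Ω K) ⧸ W) ≃ₗ[Ω] (↥(A : Submodule Ω K) ⧸ W) :=
    LinearEquiv.ofFinrankEq _ _ Subspace.dual_finrank_eq
  exact (e1.symm.trans e2.symm).trans e3
end

section
/- Let L be a finite-dimensional Lie algebra over a field Ω with a free presentation π : F → L (F a free Lie algebra, kernel R), let M be an ideal of L, and let T = π⁻¹(M) be the kernel of the composite F → L → L/M. Then the sequence 0 → (R ∩ ⟨K(F) ∩ T⟩)/⟨K(F) ∩ R⟩ → (F' ∩ R)/⟨K(F) ∩ R⟩ → (F' ∩ T)/⟨K(F) ∩ T⟩ → (M ∩ L')/⟨K(L) ∩ M⟩ → 0 is exact, where the first two maps are induced by inclusions of subspaces of F and the last map is induced by π (via the identifications B₀(L) ≅ (F' ∩ R)/⟨K(F) ∩ R⟩ and B₀(L/M) ≅ (F'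 ∩ T)/⟨K(F) ∩ T⟩). -/
variable (Ω : Type*) [Field Ω] (L : Type*) [LieRing L] [LieAlgebra Ω L]

section FiveTermHopf

variable {Ω : Type*} [Field Ω] {F : Type*} [LieRing F] [LieAlgebra Ω F]
variable {L : Type*} [LieRing L] [LieAlgebra Ω L]

/-- `R ∩ ⟨K(F) ∩ T⟩`, where `R = ker π` and `T = π⁻¹(M)`. -/
def seqA1 (π : F →ₗ⁅Ω⁆ L) (M : LieIdeal Ω L) : Submodule Ω F :=
  (π.ker : Submodule Ω F) ⊓ Submodule.span Ω (bracketSet F ∩ {x : F | π x ∈ M})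

/-- `F' ∩ R`, where `R = ker π`. -/
def seqA2 (π : F →ₗ⁅Ω⁆ L) : Submodule Ω F :=
  Submodule.span Ω (bracketSet F) ⊓ (π.ker : Submodule Ω F)

/-- `F' ∩ T`, where `T = π⁻¹(M)`. -/
def seqA3 (π : F →ₗ⁅Ω⁆ L) (M : LieIdeal Ω L) : Submodule Ω F :=
  Submodule.span Ω (bracketSet F) ⊓ (M : Submodule Ω L).comap π.toLinearMap

/-- `M ∩ L'`. -/
def seqB (M : LieIdeal Ω L) : Submodule Ω L :=
  (M : Submodule Ω L) ⊓ Submodule.span Ω (bracketSet L)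

/-- `⟨K(F) ∩ R⟩`. -/
def seqNR (π : F →ₗ⁅Ω⁆ L) : Submodule Ω F :=
  Submodule.span Ω (bracketSet F ∩ (π.ker : Set F))

/-- `⟨K(F) ∩ T⟩`. -/
def seqNT (π : F →ₗ⁅Ω⁆ L) (M : LieIdeal Ω L) : Submodule Ω F :=
  Submodule.span Ω (bracketSet F ∩ {x : F | π x ∈ M})

/-- `⟨K(L) ∩ M⟩`. -/
def seqNB (M : LieIdeal Ω L) : Submodule Ω L :=
  Submodule.span Ω (bracketSet L ∩ (M : Set L))

lemma ker_le_T (π : F →ₗ⁅Ω⁆ L) (M : LieIdeal Ω L) :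
    (π.ker : Submodule Ω F) ≤ (M : Submodule Ω L).comap π.toLinearMap := by
  intro x hx
  have h0 : π x = 0 := LieHom.mem_ker.mp hx
  show π.toLinearMap x ∈ (M : Submodule Ω L)
  simp only [LieHom.coe_toLinearMap, h0]
  exact zero_mem _

lemma seqA1_le_seqA2 (π : F →ₗ⁅Ω⁆ L) (M : LieIdeal Ω L) : seqA1 π M ≤ seqA2 π :=
  fun _ hx => ⟨Submodule.span_mono Set.inter_subset_left hx.2, hx.1⟩

lemma seqA2_le_seqA3 (π : F →ₗ⁅Ω⁆ L) (M : LieIdeal Ω L) : seqA2 π ≤ seqA3 π M :=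
  fun _ hx => ⟨hx.1, ker_le_T π M hx.2⟩

lemma seqNR_le_seqNT (π : F →ₗ⁅Ω⁆ L) (M : LieIdeal Ω L) : seqNR π ≤ seqNT π M := by
  apply Submodule.span_mono
  rintro x ⟨hx1, hx2⟩
  exact ⟨hx1, show π x ∈ M by
    have h0 : π x = 0 := LieHom.mem_ker.mp hx2
    rw [h0]; exact zero_mem _⟩

lemma seqNR_le_seqA1 (π : F →ₗ⁅Ω⁆ L) (M : LieIdeal Ω L) : seqNR π ≤ seqA1 π M := by
  refine le_inf ?_ (seqNR_le_seqNT π M)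
  apply Submodule.span_le.mpr
  rintro x ⟨_, hx2⟩
  exact hx2

lemma map_A3_le_B (π : F →ₗ⁅Ω⁆ L) (M : LieIdeal Ω L) :
    ∀ x ∈ seqA3 π M, π.toLinearMap x ∈ seqB M := by
  rintro x ⟨hx1, hx2⟩
  refine ⟨hx2, ?_⟩
  have hmap : Submodule.map π.toLinearMap (Submodule.span Ω (bracketSet F)) ≤
      Submodule.span Ω (bracketSet L) := by
    rw [Submodule.map_span]
    apply Submodule.span_le.mpr
    rintro _ ⟨w, ⟨a, b, rfl⟩, rfl⟩
    exact Submodule.subset_span ⟨π a, π b, by simp⟩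
  exact hmap ⟨x, hx1, rfl⟩

/-- The first induced map, `(R ∩ ⟨K(F) ∩ T⟩)/⟨K(F) ∩ R⟩ → (F' ∩ R)/⟨K(F) ∩ R⟩`. -/
def seqMap1 (π : F →ₗ⁅Ω⁆ L) (M : LieIdeal Ω L) :
    (↥(seqA1 π M) ⧸ (seqNR π).comap (seqA1 π M).subtype) →ₗ[Ω]
      (↥(seqA2 π) ⧸ (seqNR π).comap (seqA2 π).subtype) :=
  Submodule.mapQ _ _ (Submodule.inclusion (seqA1_le_seqA2 π M)) (fun _ hx => hx)

/-- The second induced map, `(F' ∩ R)/⟨K(F) ∩ R⟩ → (F' ∩ T)/⟨K(F) ∩ T⟩`. -/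
def seqMap2 (π : F →ₗ⁅Ω⁆ L) (M : LieIdeal Ω L) :
    (↥(seqA2 π) ⧸ (seqNR π).comap (seqA2 π).subtype) →ₗ[Ω]
      (↥(seqA3 π M) ⧸ (seqNT π M).comap (seqA3 π M).subtype) :=
  Submodule.mapQ _ _ (Submodule.inclusion (seqA2_le_seqA3 π M))
    (fun _ hx => seqNR_le_seqNT π M hx)

/-- The third induced map, `(F' ∩ T)/⟨K(F) ∩ T⟩ → (M ∩ L')/⟨K(L) ∩ M⟩`,
induced by `π`. -/
def seqMap3 (π : F →ₗ⁅Ω⁆ L) (M : LieIdeal Ω L) :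
    (↥(seqA3 π M) ⧸ (seqNT π M).comap (seqA3 π M).subtype) →ₗ[Ω]
      (↥(seqB M) ⧸ (seqNB M).comap (seqB M).subtype) :=
  Submodule.mapQ _ _ (π.toLinearMap.restrict (map_A3_le_B π M))
    (by
      intro x hx
      show (π.toLinearMap.restrict (map_A3_le_B π M) x : L) ∈ seqNB M
      have hval : (π.toLinearMap.restrict (map_A3_le_B π M) x : L) = π.toLinearMap ↑x := rfl
      rw [hval]
      have hmap : Submodule.map π.toLinearMap (seqNT π M) ≤ seqNB M := by
        rw [seqNT, Submodule.map_span]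
        apply Submodule.span_le.mpr
        rintro _ ⟨w, ⟨⟨a, b, rfl⟩, hwM⟩, rfl⟩
        refine Submodule.subset_span ⟨⟨π a, π b, by simp⟩, ?_⟩
        simpa using hwM
      exact hmap ⟨↑x, hx, rfl⟩)

end FiveTermHopf

/-- Lifting of spans of brackets along a surjection. -/
lemma exists_lift_NT {Ω F L : Type*} [Field Ω] [LieRing F] [LieAlgebra Ω F] [LieRing L]
    [LieAlgebra Ω L] (π : F →ₗ⁅Ω⁆ L) (hπ : Function.Surjective π) (S : Set L)
    (y : L) (hy : y ∈ Submodule.span Ω (bracketSet L ∩ S)) :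
    ∃ t ∈ Submodule.span Ω (bracketSet F ∩ {x : F | π x ∈ S}), π t = y := by
  have h : Submodule.span Ω (bracketSet L ∩ S) ≤ Submodule.map π.toLinearMap
      (Submodule.span Ω (bracketSet F ∩ {x : F | π x ∈ S})) := by
    apply Submodule.span_le.mpr
    rintro _ ⟨⟨a, b, rfl⟩, hS⟩
    obtain ⟨a, rfl⟩ := hπ a
    obtain ⟨b, rfl⟩ := hπ b
    exact ⟨⁅a, b⁆, Submodule.subset_span ⟨⟨a, b, rfl⟩, by simpa using hS⟩, by simp⟩
  obtain ⟨t, ht, hty⟩ := h hy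
  exact ⟨t, ht, hty⟩

/-- `⟨K(F) ∩ T⟩ ≤ F' ∩ T`. -/
lemma seqNT_le_seqA3 {Ω F L : Type*} [Field Ω] [LieRing F] [LieAlgebra Ω F] [LieRing L]
    [LieAlgebra Ω L] (π : F →ₗ⁅Ω⁆ L) (M : LieIdeal Ω L) : seqNT π M ≤ seqA3 π M := by
  refine le_inf (Submodule.span_mono Set.inter_subset_left) ?_
  apply Submodule.span_le.mpr
  rintro x ⟨_, hx⟩
  exact hx

/-- **The four-term exact sequence from the Hopf-type formula.**
Let `L` be a finite-dimensional Lie algebra with free presentation `π : F → L`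
(`F` free, `R = ker π`), `M` an ideal of `L` and `T = π⁻¹(M)`.  Then, via the
identifications `B₀(L) ≅ (F' ∩ R)/⟨K(F) ∩ R⟩` and `B₀(L/M) ≅ (F' ∩ T)/⟨K(F) ∩ T⟩`,
the sequence
`0 → (R ∩ ⟨K(F) ∩ T⟩)/⟨K(F) ∩ R⟩ → (F' ∩ R)/⟨K(F) ∩ R⟩ → (F' ∩ T)/⟨K(F) ∩ T⟩ →
(M ∩ L')/⟨K(L) ∩ M⟩ → 0`
is exact, where the first two maps are induced by inclusions and the last by `π`. -/
theorem four_term_exact_sequence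
    (Ω : Type*) [Field Ω] (L : Type*) [LieRing L] [LieAlgebra Ω L] [FiniteDimensional Ω L]
    (X : Type*) (π : FreeLieAlgebra Ω X →ₗ⁅Ω⁆ L) (hπ : Function.Surjective π)
    (M : LieIdeal Ω L) :
    Function.Injective (seqMap1 π M) ∧
    LinearMap.range (seqMap1 π M) = LinearMap.ker (seqMap2 π M) ∧
    LinearMap.range (seqMap2 π M) = LinearMap.ker (seqMap3 π M) ∧
    Function.Surjective (seqMap3 π M) := by
  refine ⟨?_, ?_, ?_, ?_⟩
  · rw [← LinearMap.ker_eq_bot, eq_bot_iff]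
    intro q hq
    obtain ⟨x, rfl⟩ := Submodule.Quotient.mk_surjective _ q
    have h1 := (Submodule.Quotient.mk_eq_zero _).mp (LinearMap.mem_ker.mp hq)
    exact (Submodule.Quotient.mk_eq_zero _).mpr h1
  · ext q
    constructor
    · rintro ⟨p, rfl⟩
      obtain ⟨x, rfl⟩ := Submodule.Quotient.mk_surjective _ p
      exact LinearMap.mem_ker.mpr ((Submodule.Quotient.mk_eq_zero _).mpr x.2.2)
    · intro hq
      obtain ⟨x, rfl⟩ := Submodule.Quotient.mk_surjective _ q
      have h2 := (Submodule.Quotient.mk_eq_zero _).mp (LinearMap.mem_ker.mp hq)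
      have h1 : (x : FreeLieAlgebra Ω X) ∈ seqNT π M := h2
      exact ⟨Submodule.Quotient.mk ⟨x, x.2.2, h1⟩, rfl⟩
  · ext q
    constructor
    · rintro ⟨p, rfl⟩
      obtain ⟨x, rfl⟩ := Submodule.Quotient.mk_surjective _ p
      refine LinearMap.mem_ker.mpr ((Submodule.Quotient.mk_eq_zero _).mpr ?_)
      have h0 : π x = 0 := LieHom.mem_ker.mp x.2.2
      show π x ∈ seqNB M
      rw [h0]
      exact zero_mem _
    · intro hq
      obtain ⟨x, rfl⟩ := Submodule.Quotient.mk_surjective _ q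
      have h2 := (Submodule.Quotient.mk_eq_zero _).mp (LinearMap.mem_ker.mp hq)
      have h1 : π x ∈ seqNB M := h2
      obtain ⟨t, ht, htx⟩ := exists_lift_NT π hπ (M : Set L) _ h1
      have htA : t ∈ seqA3 π M := seqNT_le_seqA3 π M ht
      refine ⟨Submodule.Quotient.mk ⟨x - t, Submodule.sub_mem _ x.2.1 htA.1, ?_⟩, ?_⟩
      · exact LieHom.mem_ker.mpr (by rw [map_sub, htx, sub_self])
      · refine (Submodule.Quotient.eq _).mpr ?_
        show (x : FreeLieAlgebra Ω X) - t - x ∈ seqNT π M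
        rw [sub_sub_cancel_left]
        exact Submodule.neg_mem _ ht
  · intro q
    obtain ⟨⟨y, hyM, hy⟩, rfl⟩ := Submodule.Quotient.mk_surjective _ q
    obtain ⟨t, ht, rfl⟩ := exists_lift_NT π hπ Set.univ y (by simpa using hy)
    exact ⟨Submodule.Quotient.mk ⟨t, Submodule.span_mono Set.inter_subset_left ht, hyM⟩, rfl⟩
end

section
/- Let d ≥ 2 and let L_d be the free nilpotent Lie algebra of class 2 on d generators over a field Ω (the quotient of the free Lie algebra F on d generators by the ideal [[F,F],F]). Then B₀(L_d) = 0; equivalently, every 2-cocycle f : L_d × L_d → Ω satisfying f(x,y) = 0 whenever [x,y] = 0 is a 2-coboundary. -/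
variable (Ω : Type*) [Field Ω] (L : Type*) [LieRing L] [LieAlgebra Ω L]

/-- The central extension of `L` by `Ω` attached to a 2-cocycle `f`, as a type. -/
def CentralExt {Ω : Type*} [Field Ω] {L : Type*} [LieRing L] [LieAlgebra Ω L]
    (f : L → L → Ω) (_hf : IsTwoCocycle Ω L f) := L × Ω

namespace CentralExt

variable {Ω : Type*} [Field Ω] {L : Type*} [LieRing L] [LieAlgebra Ω L]
    {f : L → L → Ω} {hf : IsTwoCocycle Ω L f}

instance : AddCommGroup (CentralExt f hf) := inferInstanceAs (AddCommGroup (L × Ω))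
instance : Module Ω (CentralExt f hf) := inferInstanceAs (Module Ω (L × Ω))

theorem skew (hf : IsTwoCocycle Ω L f) (x y : L) : f x y = - f y x := by
  obtain ⟨h1, h2, h3, h4, h5, h6⟩ := hf
  have := h5 (x + y)
  rw [h1, h2, h2, h5, h5] at this
  linear_combination this

theorem map_neg_left (hf : IsTwoCocycle Ω L f) (x y : L) : f (-x) y = - f x y := by
  obtain ⟨h1, h2, h3, h4, h5, h6⟩ := hf
  have := h3 (-1) x y
  rw [neg_one_smul] at this
  rw [this]; ring

theorem leibniz (hf : IsTwoCocycle Ω L f) (x y z : L) :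
    f x ⁅y, z⁆ = f ⁅x, y⁆ z + f y ⁅x, z⁆ := by
  have h6 := hf.2.2.2.2.2 x y z
  rw [← lie_skew z x, map_neg_left hf] at h6
  rw [skew hf x, skew hf y]
  linear_combination -h6

instance : LieRing (CentralExt f hf) where
  bracket a b := ((⁅a.1, b.1⁆, f a.1 b.1) : L × Ω)
  add_lie a b c := Prod.ext (add_lie a.1 b.1 c.1) (hf.1 a.1 b.1 c.1)
  lie_add a b c := Prod.ext (lie_add a.1 b.1 c.1) (hf.2.1 a.1 b.1 c.1)
  lie_self a := Prod.ext (lie_self a.1) (hf.2.2.2.2.1 a.1)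
  leibniz_lie a b c := Prod.ext (leibniz_lie a.1 b.1 c.1) (leibniz hf a.1 b.1 c.1)

instance : LieAlgebra Ω (CentralExt f hf) where
  lie_smul t a b := Prod.ext (lie_smul t a.1 b.1) (hf.2.2.2.1 t a.1 b.1)

/-- The projection to `L`. -/
def proj (f : L → L → Ω) (hf : IsTwoCocycle Ω L f) : CentralExt f hf →ₗ⁅Ω⁆ L where
  toFun a := a.1
  map_add' _ _ := rfl
  map_smul' _ _ := rfl
  map_lie' := rfl

/-- The linear projection to `Ω`. -/
def coord (f : L → L → Ω) (hf : IsTwoCocycle Ω L f) : CentralExt f hf →ₗ[Ω] Ω where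
  toFun a := a.2
  map_add' _ _ := rfl
  map_smul' _ _ := rfl

theorem coord_lie (a b : CentralExt f hf) :
    coord f hf ⁅a, b⁆ = f (proj f hf a) (proj f hf b) := rfl

end CentralExt

/-- The cocycle form of the theorem, for an arbitrary generating type. -/
theorem coboundary_aux {Ω : Type*} [Field Ω] {X : Type*}
    (I : LieIdeal Ω (FreeLieAlgebra Ω X))
    (hI : I = LieModule.lowerCentralSeries Ω (FreeLieAlgebra Ω X) (FreeLieAlgebra Ω X) 2)
    (f : (FreeLieAlgebra Ω X ⧸ I) → (FreeLieAlgebra Ω X ⧸ I) → Ω)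
    (hf : IsTwoCocycle Ω _ f) (hv : ∀ x y, ⁅x, y⁆ = 0 → f x y = 0) :
    IsTwoCoboundary Ω _ f := by
  let F := FreeLieAlgebra Ω X
  let q : F →ₗ⁅Ω⁆ (F ⧸ I) :=
    { (LieSubmodule.Quotient.mk' I : F →ₗ[Ω] (F ⧸ I)) with map_lie' := rfl }
  have hq : ∀ x y : F, q ⁅x, y⁆ = ⁅q x, q y⁆ := fun x y => q.map_lie x y
  let g : X → CentralExt f hf := fun i => ((q (FreeLieAlgebra.of Ω i), 0) : (F ⧸ I) × Ω)
  let φ : F →ₗ⁅Ω⁆ CentralExt f hf :=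
    FreeLieAlgebra.lift Ω g
  have hφ : (CentralExt.proj f hf).comp φ = q := by
    apply FreeLieAlgebra.hom_ext
    intro i
    have h : φ (FreeLieAlgebra.of Ω i) = g i := FreeLieAlgebra.lift_of_apply g i
    rw [LieHom.comp_apply, h]
    rfl
  have hφ' : ∀ x, CentralExt.proj f hf (φ x) = q x := fun x => by rw [← hφ]; rfl
  let s : F →ₗ[Ω] Ω := (CentralExt.coord f hf).comp (φ : F →ₗ[Ω] CentralExt f hf)
  have hs : ∀ x y : F, s ⁅x, y⁆ = f (q x) (q y) := fun x y => by
    change CentralExt.coord f hf (φ ⁅x, y⁆) = _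
    rw [LieHom.map_lie, CentralExt.coord_lie, hφ', hφ']
  have hker : I.toSubmodule ≤ LinearMap.ker s := by
    rw [hI, LieModule.lowerCentralSeries_succ, LieSubmodule.lieIdeal_oper_eq_linear_span']
    refine Submodule.span_le.2 ?_
    rintro _ ⟨x, -, y, hy, rfl⟩
    change s ⁅x, y⁆ = 0
    rw [hs]
    apply hv
    rw [← hq]
    refine (LieSubmodule.Quotient.mk_eq_zero' (N := I)).2 ?_
    rw [hI, LieModule.lowerCentralSeries_succ]
    exact LieSubmodule.lie_mem_lie (LieSubmodule.mem_top x) hy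
  refine ⟨-(I.toSubmodule.liftQ s hker), fun x y => ?_⟩
  obtain ⟨x, rfl⟩ := LieSubmodule.Quotient.surjective_mk' I x
  obtain ⟨y, rfl⟩ := LieSubmodule.Quotient.surjective_mk' I y
  have h := hs x y
  have h2 : (I.toSubmodule.liftQ s hker) (q ⁅x, y⁆) = s ⁅x, y⁆ := rfl
  rw [hq, h] at h2
  rw [LinearMap.neg_apply, neg_neg]
  exact h2.symm

/-- **Triviality of the Bogomolov multiplier of the freest generalized Heisenberg
Lie algebra.**  For `d ≥ 2`, let `L_d` be the free nilpotent Lie algebra of class 2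
on `d` generators over `Ω` (the quotient of the free Lie algebra `F` on `d`
generators by `[[F,F],F]`).  Then `B₀(L_d) = 0`; equivalently, every 2-cocycle on
`L_d` vanishing on all commuting pairs is a 2-coboundary. -/
theorem bogomolov_free_nilpotent_class_two_eq_bot
    (Ω : Type*) [Field Ω] (d : ℕ) (hd : 2 ≤ d) :
    B0 Ω (FreeLieAlgebra Ω (Fin d) ⧸
        LieModule.lowerCentralSeries Ω (FreeLieAlgebra Ω (Fin d)) (FreeLieAlgebra Ω (Fin d)) 2)
      = ⊥ ∧
    ∀ f : (FreeLieAlgebra Ω (Fin d) ⧸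
        LieModule.lowerCentralSeries Ω (FreeLieAlgebra Ω (Fin d)) (FreeLieAlgebra Ω (Fin d)) 2) →
      (FreeLieAlgebra Ω (Fin d) ⧸
        LieModule.lowerCentralSeries Ω (FreeLieAlgebra Ω (Fin d)) (FreeLieAlgebra Ω (Fin d)) 2) →
      Ω,
      f ∈ twoCocycles Ω _ → (∀ x y, ⁅x, y⁆ = 0 → f x y = 0) →
        IsTwoCoboundary Ω _ f := by
  have key : ∀ f, f ∈ twoCocycles Ω (FreeLieAlgebra Ω (Fin d) ⧸
        LieModule.lowerCentralSeries Ω (FreeLieAlgebra Ω (Fin d)) (FreeLieAlgebra Ω (Fin d)) 2) →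
      (∀ x y, ⁅x, y⁆ = 0 → f x y = 0) → IsTwoCoboundary Ω _ f :=
    fun f hf hv => coboundary_aux _ rfl f hf hv
  refine ⟨?_, key⟩
  rw [eq_bot_iff]
  rintro _ ⟨⟨f, hf⟩, hv, rfl⟩
  rw [Submodule.mem_bot, Submodule.mkQ_apply, Submodule.Quotient.mk_eq_zero]
  exact key f hf hv
end

section
/- Let n > 0 and let H_{2n+1} be the Heisenberg Lie algebra of dimension 2n+1 over a field Ω: the Lie algebra with basis x₁,…,x_{2n},v whose bracket is determined by [x_{2i−1},x_{2i}] = v = −[x_{2i},x_{2i−1}] for 1 ≤ i ≤ n, with all other brackets of basis elements equal to zero (in particular v is central). Then B₀(H_{2n+1}) = 0; equivalently, every 2-cocycle f on H_{2n+1} satisfying f(x,y) = 0 whenever [x,y] = 0 is a 2-coboundary. -/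
variable (Ω : Type*) [Field Ω] (L : Type*) [LieRing L] [LieAlgebra Ω L]

/-! ### The Heisenberg Lie algebra of dimension `2n+1`

We realize the Heisenberg Lie algebra of dimension `2n+1` over `Ω` on the vector space
`((Fin n × Fin 2) → Ω) × Ω`, with basis `x_{k,0}, x_{k,1}` (`k : Fin n`) and central `v`,
and bracket determined by `⁅x_{k,0}, x_{k,1}⁆ = v` and all other brackets of basis
elements zero; concretely `⁅(a,s), (b,t)⁆ = (0, ∑ k, (a (k,0) * b (k,1) - a (k,1) * b (k,0)))`. -/

/-- The underlying vector space of the Heisenberg Lie algebra of dimension `2n+1`. -/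
def Heisenberg (Ω : Type*) [Field Ω] (n : ℕ) : Type _ := ((Fin n × Fin 2) → Ω) × Ω

namespace Heisenberg

variable (Ω : Type*) [Field Ω] (n : ℕ)

instance : AddCommGroup (Heisenberg Ω n) :=
  inferInstanceAs (AddCommGroup (((Fin n × Fin 2) → Ω) × Ω))

instance : Module Ω (Heisenberg Ω n) :=
  inferInstanceAs (Module Ω (((Fin n × Fin 2) → Ω) × Ω))

/-- The standard symplectic form used to define the Heisenberg bracket. -/
def omega (a b : (Fin n × Fin 2) → Ω) : Ω :=
  ∑ k : Fin n, (a (k, 0) * b (k, 1) - a (k, 1) * b (k, 0))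

lemma omega_add_left (a a' b : (Fin n × Fin 2) → Ω) :
    omega Ω n (a + a') b = omega Ω n a b + omega Ω n a' b := by
  simp only [omega, Pi.add_apply, ← Finset.sum_add_distrib]
  exact Finset.sum_congr rfl fun k _ => by ring

lemma omega_add_right (a b b' : (Fin n × Fin 2) → Ω) :
    omega Ω n a (b + b') = omega Ω n a b + omega Ω n a b' := by
  simp only [omega, Pi.add_apply, ← Finset.sum_add_distrib]
  exact Finset.sum_congr rfl fun k _ => by ring

lemma omega_smul_right (t : Ω) (a b : (Fin n × Fin 2) → Ω) :
    omega Ω n a (t • b) = t * omega Ω n a b := by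
  simp only [omega, Pi.smul_apply, smul_eq_mul, Finset.mul_sum]
  exact Finset.sum_congr rfl fun k _ => by ring

lemma omega_self (a : (Fin n × Fin 2) → Ω) : omega Ω n a a = 0 :=
  Finset.sum_eq_zero fun k _ => by ring

lemma omega_zero_left (b : (Fin n × Fin 2) → Ω) : omega Ω n 0 b = 0 :=
  Finset.sum_eq_zero fun k _ => by simp

lemma omega_zero_right (a : (Fin n × Fin 2) → Ω) : omega Ω n a 0 = 0 :=
  Finset.sum_eq_zero fun k _ => by simp

instance : LieRing (Heisenberg Ω n) where
  bracket x y := (0, omega Ω n x.1 y.1)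
  add_lie x y z := by
    show (Prod.mk _ _ : Heisenberg Ω n) = (0, _) + (0, _)
    ext
    · show (0 : (Fin n × Fin 2) → Ω) _ = ((0 : (Fin n × Fin 2) → Ω) + 0) _; simp
    · show omega Ω n (x.1 + y.1) z.1 = omega Ω n x.1 z.1 + omega Ω n y.1 z.1
      exact omega_add_left Ω n _ _ _
  lie_add x y z := by
    show (Prod.mk _ _ : Heisenberg Ω n) = (0, _) + (0, _)
    ext
    · show (0 : (Fin n × Fin 2) → Ω) _ = ((0 : (Fin n × Fin 2) → Ω) + 0) _; simp
    · show omega Ω n x.1 (y.1 + z.1) = omega Ω n x.1 y.1 + omega Ω n x.1 z.1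
      exact omega_add_right Ω n _ _ _
  lie_self x := by
    show (Prod.mk _ _ : Heisenberg Ω n) = 0
    ext
    · rfl
    · exact omega_self Ω n x.1
  leibniz_lie x y z := by
    show (Prod.mk _ (omega Ω n x.1 0) : Heisenberg Ω n) = (0, _) + (0, _)
    ext
    · show (0 : (Fin n × Fin 2) → Ω) _ = ((0 : (Fin n × Fin 2) → Ω) + 0) _; simp
    · show omega Ω n x.1 0 = omega Ω n 0 z.1 + omega Ω n y.1 0
      simp [omega_zero_left, omega_zero_right]

instance : LieAlgebra Ω (Heisenberg Ω n) where
  lie_smul t x y := by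
    show (Prod.mk _ _ : Heisenberg Ω n) = t • (0, _)
    ext
    · show (0 : (Fin n × Fin 2) → Ω) _ = (t • (0 : (Fin n × Fin 2) → Ω)) _; simp
    · show omega Ω n x.1 (t • y.1) = t • omega Ω n x.1 y.1
      simpa [smul_eq_mul] using omega_smul_right Ω n t x.1 y.1

/-- The basis vectors `xᵢ` of the Heisenberg Lie algebra. -/
noncomputable def x (k : Fin n) (j : Fin 2) : Heisenberg Ω n := (Pi.single (k, j) 1, 0)

/-- The central basis vector `v` of the Heisenberg Lie algebra. -/
def v : Heisenberg Ω n := (0, 1)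

end Heisenberg

theorem heis_coboundary (Ω : Type*) [Field Ω] (n : ℕ) (hn : 0 < n)
    (f : Heisenberg Ω n → Heisenberg Ω n → Ω)
    (hf : f ∈ twoCocycles Ω (Heisenberg Ω n))
    (hc : ∀ x y, ⁅x, y⁆ = 0 → f x y = 0) :
    IsTwoCoboundary Ω (Heisenberg Ω n) f := by
  obtain ⟨h1, h2, h3, h4, -, -⟩ := hf
  let w : Heisenberg Ω n → Heisenberg Ω n → Ω := fun x y => Heisenberg.omega Ω n x.1 y.1
  have hbr : ∀ x y : Heisenberg Ω n, ⁅x, y⁆ = ((0, w x y) : ((Fin n × Fin 2) → Ω) × Ω) :=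
    fun x y => rfl
  have hc' : ∀ x y, w x y = 0 → f x y = 0 := by
    intro x y h
    apply hc
    rw [hbr, h]
    rfl
  have w1 : ∀ x x' y, w (x + x') y = w x y + w x' y :=
    fun x x' y => Heisenberg.omega_add_left Ω n x.1 x'.1 y.1
  have w2 : ∀ x y y', w x (y + y') = w x y + w x y' :=
    fun x y y' => Heisenberg.omega_add_right Ω n x.1 y.1 y'.1
  have w4 : ∀ (t : Ω) x y, w x (t • y) = t * w x y :=
    fun t x y => Heisenberg.omega_smul_right Ω n t x.1 y.1
  have w3 : ∀ (t : Ω) x y, w (t • x) y = t * w x y := by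
    intro t x y
    show ∑ k : Fin n, ((t * x.1 (k, 0)) * y.1 (k, 1) - (t * x.1 (k, 1)) * y.1 (k, 0)) =
      t * ∑ k : Fin n, (x.1 (k, 0) * y.1 (k, 1) - x.1 (k, 1) * y.1 (k, 0))
    rw [Finset.mul_sum]
    exact Finset.sum_congr rfl fun k _ => by ring
  obtain ⟨e, e', he⟩ : ∃ e e', w e e' = 1 := by
    refine ⟨Heisenberg.x Ω n ⟨0, hn⟩ 0, Heisenberg.x Ω n ⟨0, hn⟩ 1, ?_⟩
    simp [w, Heisenberg.x, Heisenberg.omega, Pi.single_apply]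
  have key : ∀ x, w x e' ≠ 0 → ∀ y, f x y = f e e' * w x y := by
    intro x hx y
    have a := hc' (x + (-(w x e')) • e) e' (by rw [w1, w3, he]; ring)
    have b := hc' x (y + (-(w x y / w x e')) • e') (by rw [w2, w4]; field_simp; ring)
    rw [h1, h3] at a
    rw [h2, h4] at b
    have a' : f x e' = w x e' * f e e' := by linear_combination a
    rw [a'] at b
    field_simp at b
    linear_combination b
  have main : ∀ x y, f x y = f e e' * w x y := by
    intro x y
    by_cases hx : w x e' = 0
    · have a := key (x + e) (by rw [w1, hx, he]; simp) y
      have b := key e (by rw [he]; simp) y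
      rw [h1, w1] at a
      linear_combination a - b
    · exact key x hx y
  refine ⟨(-(f e e')) • (LinearMap.snd Ω ((Fin n × Fin 2) → Ω) Ω : _), fun x y => ?_⟩
  rw [main]
  show _ = -(-(f e e') * w x y)
  ring

theorem bogomolov_heisenberg_eq_bot (Ω : Type*) [Field Ω] (n : ℕ) (hn : 0 < n) :
    B0 Ω (Heisenberg Ω n) = ⊥ ∧
    ∀ f : Heisenberg Ω n → Heisenberg Ω n → Ω,
      f ∈ twoCocycles Ω (Heisenberg Ω n) →
      (∀ x y, ⁅x, y⁆ = 0 → f x y = 0) →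
      IsTwoCoboundary Ω (Heisenberg Ω n) f := by
  refine ⟨?_, heis_coboundary Ω n hn⟩
  rw [eq_bot_iff]
  rintro _ ⟨⟨f, hf⟩, hv, rfl⟩
  rw [Submodule.mem_bot, Submodule.mkQ_apply, Submodule.Quotient.mk_eq_zero]
  exact heis_coboundary Ω n hn f hf hv
end

section
/- Let L and M be finite-dimensional Lie algebras over a field Ω that are isoclinic via isomorphisms α : L/Z(L) → M/Z(M) and β : L' → M'. Let f : L × L → Ω be a 2-cocycle with f(x,y) = 0 whenever [x,y] = 0. Then there exists a well-defined map c_f : M × M → Ω given by c_f(m₁,m₂) = f(l₁,l₂) whenever α(lᵢ + Z(L)) = mᵢ + Z(M) for i = 1,2 (the value is independent of the choice of the lᵢ), and c_f is a 2-cocycle on M satisfying c_f(m₁,m₂) = 0 whenever [m₁,m₂] = 0, so its class lies in B₀(M). -/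
variable (Ω : Type*) [Field Ω] (L : Type*) [LieRing L] [LieAlgebra Ω L]

/-- Let `L` and `M` be isoclinic finite-dimensional Lie algebras over `Ω`, via
`α : L/Z(L) ≃ M/Z(M)` and `β : L' ≃ M'`, and let `f` be a 2-cocycle on `L` vanishing
on all commuting pairs.  Then there is a (well-defined) map `c_f : M × M → Ω` with
`c_f (m₁, m₂) = f (l₁, l₂)` whenever `α (lᵢ + Z(L)) = mᵢ + Z(M)`; it is a 2-cocycle
on `M` vanishing on all commuting pairs, and its cohomology class lies in `B₀(M)`. -/
theorem isoclinism_transfer_cocycle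
    (Ω : Type*) [Field Ω]
    (L : Type*) [LieRing L] [LieAlgebra Ω L] [FiniteDimensional Ω L]
    (M : Type*) [LieRing M] [LieAlgebra Ω M] [FiniteDimensional Ω M]
    (α : (L ⧸ LieAlgebra.center Ω L) ≃ₗ⁅Ω⁆ (M ⧸ LieAlgebra.center Ω M))
    (β : ↥(LieAlgebra.derivedSeries Ω L 1) ≃ₗ⁅Ω⁆ ↥(LieAlgebra.derivedSeries Ω M 1))
    (hcompat : ∀ (x : LieAlgebra.derivedSeries Ω L 1) (l₁ l₂ : L) (m₁ m₂ : M),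
      (x : L) = ⁅l₁, l₂⁆ →
      α (LieSubmodule.Quotient.mk (N := LieAlgebra.center Ω L) l₁) =
        LieSubmodule.Quotient.mk (N := LieAlgebra.center Ω M) m₁ →
      α (LieSubmodule.Quotient.mk (N := LieAlgebra.center Ω L) l₂) =
        LieSubmodule.Quotient.mk (N := LieAlgebra.center Ω M) m₂ →
      ((β x : ↥(LieAlgebra.derivedSeries Ω M 1)) : M) = ⁅m₁, m₂⁆)
    (f : L → L → Ω) (hf : f ∈ twoCocycles Ω L)
    (hvan : ∀ x y : L, ⁅x, y⁆ = 0 → f x y = 0) :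
    ∃ (c : M → M → Ω) (hc : c ∈ twoCocycles Ω M),
      (∀ (l₁ l₂ : L) (m₁ m₂ : M),
        α (LieSubmodule.Quotient.mk (N := LieAlgebra.center Ω L) l₁) =
          LieSubmodule.Quotient.mk (N := LieAlgebra.center Ω M) m₁ →
        α (LieSubmodule.Quotient.mk (N := LieAlgebra.center Ω L) l₂) =
          LieSubmodule.Quotient.mk (N := LieAlgebra.center Ω M) m₂ →
        c m₁ m₂ = f l₁ l₂) ∧
      (∀ m₁ m₂ : M, ⁅m₁, m₂⁆ = 0 → c m₁ m₂ = 0) ∧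
      H2class Ω M c hc ∈ B0 Ω M := by
  have hf' := hf
  obtain ⟨h1, h2, h3, h4, h5, h6⟩ := hf'
  have hsurj : ∀ m : M, ∃ l : L,
      α (LieSubmodule.Quotient.mk (N := LieAlgebra.center Ω L) l) =
        LieSubmodule.Quotient.mk (N := LieAlgebra.center Ω M) m := by
    intro m
    obtain ⟨l, hl⟩ := LieSubmodule.Quotient.surjective_mk' (LieAlgebra.center Ω L)
      (α.symm (LieSubmodule.Quotient.mk (N := LieAlgebra.center Ω M) m))
    refine ⟨l, ?_⟩
    have hl' : LieSubmodule.Quotient.mk (N := LieAlgebra.center Ω L) l =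
      α.symm (LieSubmodule.Quotient.mk (N := LieAlgebra.center Ω M) m) := hl
    rw [hl', LieEquiv.apply_symm_apply]
  choose g hg using hsurj
  have hneg : ∀ x y : L, f x y = - f y x := by
    intro x y
    have h := h5 (x + y)
    rw [h1, h2, h2, h5, h5] at h
    linear_combination h
  have hcen : ∀ l l' : L, LieSubmodule.Quotient.mk (N := LieAlgebra.center Ω L) l =
      LieSubmodule.Quotient.mk (N := LieAlgebra.center Ω L) l' → ∀ y, f l y = f l' y := by
    intro l l' h y
    have hz : l - l' ∈ LieAlgebra.center Ω L :=
      (Submodule.Quotient.eq (LieAlgebra.center Ω L).toSubmodule).1 h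
    have hb : ⁅l - l', y⁆ = 0 := by
      rw [← lie_skew, (LieModule.mem_maxTrivSubmodule Ω L L _).1 hz y, neg_zero]
    have h0 := hvan _ _ hb
    have h7 := h1 (l - l') l' y
    rw [sub_add_cancel, h0, zero_add] at h7
    exact h7
  have hwd : ∀ (l₁ l₂ : L) (m₁ m₂ : M),
        α (LieSubmodule.Quotient.mk (N := LieAlgebra.center Ω L) l₁) =
          LieSubmodule.Quotient.mk (N := LieAlgebra.center Ω M) m₁ →
        α (LieSubmodule.Quotient.mk (N := LieAlgebra.center Ω L) l₂) =
          LieSubmodule.Quotient.mk (N := LieAlgebra.center Ω M) m₂ →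
        f (g m₁) (g m₂) = f l₁ l₂ := by
    intro l₁ l₂ m₁ m₂ e1 e2
    rw [hcen (g m₁) l₁ (α.injective ((hg m₁).trans e1.symm)), hneg,
      hcen (g m₂) l₂ (α.injective ((hg m₂).trans e2.symm)), ← hneg]
  have radd : ∀ m m' : M,
      α (LieSubmodule.Quotient.mk (N := LieAlgebra.center Ω L) (g m + g m')) =
        LieSubmodule.Quotient.mk (N := LieAlgebra.center Ω M) (m + m') := by
    intro m m'
    have e : α (LieSubmodule.Quotient.mk (N := LieAlgebra.center Ω L) (g m) +
      LieSubmodule.Quotient.mk (N := LieAlgebra.center Ω L) (g m')) =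
        LieSubmodule.Quotient.mk (N := LieAlgebra.center Ω M) m +
        LieSubmodule.Quotient.mk (N := LieAlgebra.center Ω M) m' := by
      rw [← hg, ← hg]; exact map_add α.toLinearEquiv _ _
    exact e
  have rsmul : ∀ (a : Ω) (m : M),
      α (LieSubmodule.Quotient.mk (N := LieAlgebra.center Ω L) (a • g m)) =
        LieSubmodule.Quotient.mk (N := LieAlgebra.center Ω M) (a • m) := by
    intro a m
    have e : α (a • LieSubmodule.Quotient.mk (N := LieAlgebra.center Ω L) (g m)) =
        a • LieSubmodule.Quotient.mk (N := LieAlgebra.center Ω M) m := by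
      rw [← hg]; exact map_smul α.toLinearEquiv _ _
    exact e
  have rlie : ∀ m m' : M,
      α (LieSubmodule.Quotient.mk (N := LieAlgebra.center Ω L) ⁅g m, g m'⁆) =
        LieSubmodule.Quotient.mk (N := LieAlgebra.center Ω M) ⁅m, m'⁆ := by
    intro m m'
    rw [LieSubmodule.Quotient.mk_bracket, LieSubmodule.Quotient.mk_bracket, ← hg, ← hg]
    exact LieEquiv.map_lie α _ _
  have hc : (fun m₁ m₂ => f (g m₁) (g m₂)) ∈ twoCocycles Ω M := by
    refine ⟨fun x x' y => ?_, fun x y y' => ?_, fun a x y => ?_, fun a x y => ?_,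
      fun x => h5 _, fun x y z => ?_⟩
    · exact (hwd _ _ _ _ (radd x x') (hg y)).trans (h1 _ _ _)
    · exact (hwd _ _ _ _ (hg x) (radd y y')).trans (h2 _ _ _)
    · exact (hwd _ _ _ _ (rsmul a x) (hg y)).trans (h3 _ _ _)
    · exact (hwd _ _ _ _ (hg x) (rsmul a y)).trans (h4 _ _ _)
    · have := h6 (g x) (g y) (g z)
      rw [← hwd _ _ _ _ (rlie x y) (hg z), ← hwd _ _ _ _ (rlie y z) (hg x),
        ← hwd _ _ _ _ (rlie z x) (hg y)] at this
      exact this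
  have hv : ∀ m₁ m₂ : M, ⁅m₁, m₂⁆ = 0 → f (g m₁) (g m₂) = 0 := by
    intro m₁ m₂ h
    apply hvan
    have hmem : ⁅g m₁, g m₂⁆ ∈ LieAlgebra.derivedSeries Ω L 1 :=
      LieSubmodule.lie_mem_lie (LieSubmodule.mem_top _) (LieSubmodule.mem_top _)
    have hb := hcompat ⟨_, hmem⟩ _ _ _ _ rfl (hg m₁) (hg m₂)
    rw [h] at hb
    have hb0 : β ⟨_, hmem⟩ = β 0 := by
      apply Subtype.ext
      rw [hb]
      exact (congrArg Subtype.val (map_zero β.toLinearEquiv)).symm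
    exact congrArg Subtype.val (β.injective hb0)
  exact ⟨_, hc, hwd, hv, ⟨⟨_, hc⟩, hv, rfl⟩⟩
end

section
/- Let n ≥ 1, let d > 4n, and let L_d be the free nilpotent Lie algebra of class 2 on d generators x₁,…,x_d over a field Ω. Let M be the ideal of L_d generated by the elements [x_{4k+1}, x_{4k+2}] + [x_{4k+3}, x_{4k+4}] for k = 0, 1, …, n−1. Then K(L_d) ∩ M = {0}, i.e., the only element of M that is a bracket [x,y] of two elements of L_d is 0. -/
variable (Ω : Type*) [Field Ω] (L : Type*) [LieRing L] [LieAlgebra Ω L]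

/-- The free nilpotent Lie algebra of class 2 on `d` generators over `Ω`:
the quotient of the free Lie algebra `F` on `d` generators by `[[F,F],F]`. -/
abbrev freeNilpotentClassTwo (Ω : Type*) [Field Ω] (d : ℕ) :=
  FreeLieAlgebra Ω (Fin d) ⧸
    LieModule.lowerCentralSeries Ω (FreeLieAlgebra Ω (Fin d)) (FreeLieAlgebra Ω (Fin d)) 2

/-- The `i`-th canonical generator `xᵢ` of the free nilpotent Lie algebra of class 2. -/
noncomputable def freeNilpotentClassTwo.x (Ω : Type*) [Field Ω] (d : ℕ) (i : Fin d) :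
    freeNilpotentClassTwo Ω d :=
  LieSubmodule.Quotient.mk (FreeLieAlgebra.of Ω i)

/-- Concrete class-two model: vectors together with matrices. -/
def ModelT (Ω : Type*) (d : ℕ) := (Fin d → Ω) × (Fin d → Fin d → Ω)

instance modelAddCommGroup (Ω : Type*) [Field Ω] (d : ℕ) : AddCommGroup (ModelT Ω d) :=
  inferInstanceAs (AddCommGroup ((Fin d → Ω) × (Fin d → Fin d → Ω)))

instance modelModule (Ω : Type*) [Field Ω] (d : ℕ) : Module Ω (ModelT Ω d) :=
  inferInstanceAs (Module Ω ((Fin d → Ω) × (Fin d → Fin d → Ω)))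

namespace ModelT

/-- Vector part. -/
def vec {Ω : Type*} [Field Ω] {d : ℕ} : ModelT Ω d →ₗ[Ω] (Fin d → Ω) :=
  LinearMap.fst Ω (Fin d → Ω) (Fin d → Fin d → Ω)

/-- Matrix part. -/
def mat {Ω : Type*} [Field Ω] {d : ℕ} : ModelT Ω d →ₗ[Ω] (Fin d → Fin d → Ω) :=
  LinearMap.snd Ω (Fin d → Ω) (Fin d → Fin d → Ω)

theorem ext' {Ω : Type*} [Field Ω] {d : ℕ} {a b : ModelT Ω d}
    (h1 : ∀ i, vec a i = vec b i) (h2 : ∀ i j, mat a i j = mat b i j) : a = b :=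
  Prod.ext (funext h1) (funext fun i => funext (h2 i))

instance (Ω : Type*) [Field Ω] (d : ℕ) : Bracket (ModelT Ω d) (ModelT Ω d) :=
  ⟨fun a b => (0, fun i j => vec a i * vec b j - vec a j * vec b i)⟩

theorem vec_lie {Ω : Type*} [Field Ω] {d : ℕ} (a b : ModelT Ω d) : vec ⁅a, b⁆ = 0 := rfl

theorem mat_lie {Ω : Type*} [Field Ω] {d : ℕ} (a b : ModelT Ω d) (i j : Fin d) :
    mat ⁅a, b⁆ i j = vec a i * vec b j - vec a j * vec b i := rfl

instance (Ω : Type*) [Field Ω] (d : ℕ) : LieRing (ModelT Ω d) where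
  add_lie a b c := by
    apply ext'
    · intro i; simp [vec_lie]
    · intro i j; simp only [map_add, Pi.add_apply, mat_lie]; ring
  lie_add a b c := by
    apply ext'
    · intro i; simp [vec_lie]
    · intro i j; simp only [map_add, Pi.add_apply, mat_lie]; ring
  lie_self a := by
    apply ext'
    · intro i; simp [vec_lie]
    · intro i j; simp only [map_zero, Pi.zero_apply, mat_lie]; ring
  leibniz_lie a b c := by
    apply ext'
    · intro i; simp [vec_lie]
    · intro i j; simp [mat_lie, vec_lie]

instance (Ω : Type*) [Field Ω] (d : ℕ) : LieAlgebra Ω (ModelT Ω d) where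
  lie_smul t a b := by
    apply ext'
    · intro i; simp [vec_lie]
    · intro i j; simp only [map_smul, Pi.smul_apply, smul_eq_mul, mat_lie]; ring

/-- Standard generators. -/
def gen (Ω : Type*) [Field Ω] (d : ℕ) (i : Fin d) : ModelT Ω d := (Pi.single i 1, 0)

theorem vec_gen {Ω : Type*} [Field Ω] {d : ℕ} (i j : Fin d) :
    vec (gen Ω d i) j = if j = i then 1 else 0 := by
  change (Pi.single i (1 : Ω) : Fin d → Ω) j = _
  rw [Pi.single_apply]

/-- The homomorphism from the free Lie algebra. -/
noncomputable def phi (Ω : Type*) [Field Ω] (d : ℕ) : FreeLieAlgebra Ω (Fin d) →ₗ⁅Ω⁆ ModelT Ω d :=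
  FreeLieAlgebra.lift Ω (gen Ω d)

/-- Elements of the free Lie algebra with zero vector part. -/
noncomputable def vecKer (Ω : Type*) [Field Ω] (d : ℕ) : LieIdeal Ω (FreeLieAlgebra Ω (Fin d)) where
  carrier := {m | vec (phi Ω d m) = 0}
  add_mem' := by
    intro a b ha hb
    simp only [Set.mem_ofPred_eq] at *
    rw [map_add, map_add, ha, hb, add_zero]
  zero_mem' := by simp
  smul_mem' := by
    intro c a ha
    simp only [Set.mem_ofPred_eq] at *
    rw [map_smul, map_smul, ha, smul_zero]
  lie_mem := by
    intro x m _
    change vec (phi Ω d ⁅x, m⁆) = 0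
    rw [LieHom.map_lie, vec_lie]

theorem phi_lcs {Ω : Type*} [Field Ω] {d : ℕ} {z : FreeLieAlgebra Ω (Fin d)}
    (hz : z ∈ LieModule.lowerCentralSeries Ω (FreeLieAlgebra Ω (Fin d))
      (FreeLieAlgebra Ω (Fin d)) 2) : phi Ω d z = 0 := by
  have h1 : LieModule.lowerCentralSeries Ω (FreeLieAlgebra Ω (Fin d))
      (FreeLieAlgebra Ω (Fin d)) 1 ≤ vecKer Ω d := by
    rw [LieModule.lowerCentralSeries_succ, LieSubmodule.lie_le_iff]
    intro x _ m _
    change vec (phi Ω d ⁅x, m⁆) = 0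
    rw [LieHom.map_lie, vec_lie]
  have h2 : LieModule.lowerCentralSeries Ω (FreeLieAlgebra Ω (Fin d))
      (FreeLieAlgebra Ω (Fin d)) 2 ≤ (phi Ω d).ker := by
    rw [LieModule.lowerCentralSeries_succ, LieSubmodule.lie_le_iff]
    intro x _ m hm
    have h : vec (phi Ω d m) = 0 := h1 hm
    rw [LieHom.mem_ker, LieHom.map_lie]
    apply ext'
    · intro i; simp [vec_lie]
    · intro i j; simp [mat_lie, h]
  exact LieHom.mem_ker.1 (h2 hz)

end ModelT

theorem fn2_triple {Ω : Type*} [Field Ω] {d : ℕ} (x y z : freeNilpotentClassTwo Ω d) :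
    ⁅x, ⁅y, z⁆⁆ = 0 := by
  obtain ⟨x, rfl⟩ := LieSubmodule.Quotient.surjective_mk' _ x
  obtain ⟨y, rfl⟩ := LieSubmodule.Quotient.surjective_mk' _ y
  obtain ⟨z, rfl⟩ := LieSubmodule.Quotient.surjective_mk' _ z
  change LieSubmodule.Quotient.mk (⁅x, ⁅y, z⁆⁆) = _
  refine (LieSubmodule.Quotient.mk_eq_zero _).2 ?_
  rw [LieModule.lowerCentralSeries_succ]
  apply LieSubmodule.lie_mem_lie (LieSubmodule.mem_top _)
  rw [LieModule.lowerCentralSeries_succ]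
  exact LieSubmodule.lie_mem_lie (LieSubmodule.mem_top _) (by simp)

/-- The index `4k + a`. -/
def blockIdx {n d : ℕ} (hd : 4 * n < d) (k : Fin n) (a : Fin 4) : Fin d :=
  ⟨4 * k.1 + a.1, by have := k.2; have := a.2; omega⟩

/-- Lifted relators. -/
noncomputable def relator (Ω : Type*) [Field Ω] {n d : ℕ} (hd : 4 * n < d) (k : Fin n) :
    FreeLieAlgebra Ω (Fin d) :=
  ⁅FreeLieAlgebra.of Ω (blockIdx hd k 0),
    FreeLieAlgebra.of Ω (blockIdx hd k 1)⁆ +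
  ⁅FreeLieAlgebra.of Ω (blockIdx hd k 2),
    FreeLieAlgebra.of Ω (blockIdx hd k 3)⁆

theorem mat_relator {Ω : Type*} [Field Ω] {n d : ℕ} (hd : 4 * n < d) (k : Fin n) (i j : Fin d) :
    ModelT.mat (ModelT.phi Ω d (relator Ω hd k)) i j =
      ((if i.1 = 4 * k.1 then 1 else 0) * (if j.1 = 4 * k.1 + 1 then 1 else 0)
       - (if j.1 = 4 * k.1 then 1 else 0) * (if i.1 = 4 * k.1 + 1 then 1 else 0)) +
      ((if i.1 = 4 * k.1 + 2 then 1 else 0) * (if j.1 = 4 * k.1 + 3 then 1 else 0)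
       - (if j.1 = 4 * k.1 + 2 then 1 else 0) * (if i.1 = 4 * k.1 + 3 then 1 else 0)) := by
  simp only [relator, map_add, LieHom.map_lie, Pi.add_apply, ModelT.mat_lie, ModelT.phi,
    FreeLieAlgebra.lift_of_apply, ModelT.vec_gen, Fin.ext_iff, blockIdx]
  rfl

theorem mat_sum {Ω : Type*} [Field Ω] {n d : ℕ} (hd : 4 * n < d) (c : Fin n → Ω) (k : Fin n)
    (a b : ℕ) (ha : a < 4) (hb : b < 4) :
    ModelT.mat (ModelT.phi Ω d (∑ l, c l • relator Ω hd l))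
      ⟨4 * k.1 + a, by have := k.2; omega⟩ ⟨4 * k.1 + b, by have := k.2; omega⟩ =
    c k * (((if a = 0 then 1 else 0) * (if b = 1 then 1 else 0)
       - (if b = 0 then 1 else 0) * (if a = 1 then 1 else 0)) +
      ((if a = 2 then 1 else 0) * (if b = 3 then 1 else 0)
       - (if b = 2 then 1 else 0) * (if a = 3 then 1 else 0))) := by
  simp only [map_sum, map_smul, Finset.sum_apply, Pi.smul_apply, mat_relator, smul_eq_mul]
  rw [Finset.sum_eq_single k]
  · simp
  · intro l _ hl
    have hl' : l.1 ≠ k.1 := fun h => hl (Fin.ext h)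
    have e0 : 4 * k.1 + a ≠ 4 * l.1 := by omega
    have e1 : 4 * k.1 + a ≠ 4 * l.1 + 1 := by omega
    have e2 : 4 * k.1 + a ≠ 4 * l.1 + 2 := by omega
    have e3 : 4 * k.1 + a ≠ 4 * l.1 + 3 := by omega
    simp only [if_neg e0, if_neg e1, if_neg e2, if_neg e3]
    ring
  · simp

/-- Let `n ≥ 1`, `d > 4n`, let `L_d` be the free nilpotent Lie algebra of class 2 on
`d` generators `x₁, …, x_d` over `Ω`, and let `M` be the ideal generated by the
elements `⁅x_{4k+1}, x_{4k+2}⁆ + ⁅x_{4k+3}, x_{4k+4}⁆`, `k = 0, …, n-1` (written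
here with 0-based indices).  Then `K(L_d) ∩ M = {0}`. -/
theorem bracketSet_inter_ideal_eq_singleton_zero
    (Ω : Type*) [Field Ω] (n d : ℕ) (hn : 1 ≤ n) (hd : 4 * n < d)
    (M : LieIdeal Ω (freeNilpotentClassTwo Ω d))
    (hM : M = LieSubmodule.lieSpan Ω (freeNilpotentClassTwo Ω d)
      {w | ∃ k : Fin n,
        w = ⁅freeNilpotentClassTwo.x Ω d ⟨4 * k.1, by have := k.2; omega⟩,
              freeNilpotentClassTwo.x Ω d ⟨4 * k.1 + 1, by have := k.2; omega⟩⁆ +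
            ⁅freeNilpotentClassTwo.x Ω d ⟨4 * k.1 + 2, by have := k.2; omega⟩,
              freeNilpotentClassTwo.x Ω d ⟨4 * k.1 + 3, by have := k.2; omega⟩⁆}) :
    bracketSet (freeNilpotentClassTwo Ω d) ∩ (M : Set (freeNilpotentClassTwo Ω d)) = {0} := by
  have key : ∀ m ∈ M, ∃ c : Fin n → Ω,
      m = LieSubmodule.Quotient.mk (∑ l, c l • relator Ω hd l) := by
    intro m hm
    rw [hM] at hm
    induction hm using LieSubmodule.lieSpan_induction with
    | mem w hw =>
      obtain ⟨k, rfl⟩ := hw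
      refine ⟨Pi.single k 1, ?_⟩
      have : ∑ l, (Pi.single k 1 : Fin n → Ω) l • relator Ω hd l = relator Ω hd k := by
        simp [Pi.single_apply]
      rw [this]
      rfl
    | zero => exact ⟨0, by simp only [Pi.zero_apply, zero_smul, Finset.sum_const_zero]; rfl⟩
    | add x y _ _ hx hy =>
      obtain ⟨c, rfl⟩ := hx
      obtain ⟨e, rfl⟩ := hy
      refine ⟨c + e, ?_⟩
      simp only [Pi.add_apply, add_smul, Finset.sum_add_distrib]
      rfl
    | smul a x _ hx =>
      obtain ⟨c, rfl⟩ := hx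
      refine ⟨a • c, ?_⟩
      simp only [Pi.smul_apply, smul_assoc, ← Finset.smul_sum]
      rfl
    | lie x y _ hy =>
      obtain ⟨c, rfl⟩ := hy
      refine ⟨0, ?_⟩
      simp only [Pi.zero_apply, zero_smul, Finset.sum_const_zero]
      change ⁅x, LieSubmodule.Quotient.mk' _ (∑ l, c l • relator Ω hd l)⁆ = 0
      rw [map_sum, lie_sum]
      refine Finset.sum_eq_zero fun l _ => ?_
      rw [map_smul, lie_smul]
      have : ⁅x, LieSubmodule.Quotient.mk' (LieModule.lowerCentralSeries Ω
          (FreeLieAlgebra Ω (Fin d)) (FreeLieAlgebra Ω (Fin d)) 2) (relator Ω hd l)⁆ = 0 := by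
        rw [relator, map_add]
        refine (LieRing.lie_add x _ _).trans ?_
        refine (congrArg₂ (· + ·)
          (fn2_triple x (freeNilpotentClassTwo.x Ω d (blockIdx hd l 0))
            (freeNilpotentClassTwo.x Ω d (blockIdx hd l 1)))
          (fn2_triple x (freeNilpotentClassTwo.x Ω d (blockIdx hd l 2))
            (freeNilpotentClassTwo.x Ω d (blockIdx hd l 3)))).trans (add_zero 0)
      rw [this, smul_zero]
  ext m
  simp only [Set.mem_inter_iff, SetLike.mem_coe, Set.mem_singleton_iff]
  constructor
  · rintro ⟨⟨x, y, hxy⟩, hm⟩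
    obtain ⟨c, hc⟩ := key m hm
    obtain ⟨x, rfl⟩ := LieSubmodule.Quotient.surjective_mk' _ x
    obtain ⟨y, rfl⟩ := LieSubmodule.Quotient.surjective_mk' _ y
    have h1 : ⁅x, y⁆ - (∑ l, c l • relator Ω hd l) ∈ LieModule.lowerCentralSeries Ω
          (FreeLieAlgebra Ω (Fin d)) (FreeLieAlgebra Ω (Fin d)) 2 := by
      rw [← LieSubmodule.Quotient.mk_eq_zero]
      have : (LieSubmodule.Quotient.mk ⁅x, y⁆ : freeNilpotentClassTwo Ω d)
          = LieSubmodule.Quotient.mk (∑ l, c l • relator Ω hd l) := hxy.symm.trans hc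
      exact sub_eq_zero.2 this
    have h2 := ModelT.phi_lcs h1
    rw [map_sub, sub_eq_zero, LieHom.map_lie] at h2
    have hck : ∀ k, c k = 0 := by
      intro k
      have e := fun a b ha hb => mat_sum hd c k a b ha hb
      simp only [← h2, ModelT.mat_lie] at e
      have e01 := e 0 1 (by norm_num) (by norm_num)
      have e23 := e 2 3 (by norm_num) (by norm_num)
      have e02 := e 0 2 (by norm_num) (by norm_num)
      have e13 := e 1 3 (by norm_num) (by norm_num)
      have e03 := e 0 3 (by norm_num) (by norm_num)
      have e12 := e 1 2 (by norm_num) (by norm_num)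
      clear e
      norm_num at e01 e23 e02 e13 e03 e12
      generalize ModelT.vec (ModelT.phi Ω d x) = u at *
      generalize ModelT.vec (ModelT.phi Ω d y) = v at *
      have : c k * c k = 0 := by
        grind
      simpa using this
    rw [hc]
    simp only [hck, zero_smul, Finset.sum_const_zero]
    rfl
  · rintro rfl
    exact ⟨⟨0, 0, by simp⟩, M.zero_mem⟩
end
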